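/- For every ε > 0 and η = ε²/1225, the following holds for all 0 < δ < δ₀(s,t,ε): let (𝒫, 𝒯) be a (δ, s, δ^{−η}, M)-nice configuration with s ∈ (0,1], |𝒫| ∼ δ^{−t}, t ∈ [s, 2−s], and suppose 𝒫 satisfies the spacing condition |𝒫 ∩ Q|_δ ≲ δ^{−η} · max( ρ^{2−s} |𝒫|_δ, (ρ/δ)^s ) for every Q ∈ 𝒟_ρ(𝒫) and every δ ≤ ρ ≤ 1. Then |𝒯|_δ ≳_ε δ^{−(s+t)/2 + ε} · M. -/

import Mathlib

open Set Metric
open scoped Classical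

noncomputable section

/-- The half-open dyadic square of side-length `δ` with index `q`. -/
def dSq (δ : ℝ) (q : ℤ × ℤ) : Set (ℝ × ℝ) :=
  Set.Ico ((q.1 : ℝ) * δ) (((q.1 : ℝ) + 1) * δ) ×ˢ Set.Ico ((q.2 : ℝ) * δ) (((q.2 : ℝ) + 1) * δ)

/-- The dyadic `δ`-covering number of a planar set. -/
def covNum (δ : ℝ) (P : Set (ℝ × ℝ)) : ℕ :=
  Nat.card {q : ℤ × ℤ | (dSq δ q ∩ P).Nonempty}

/-- The dyadic `δ`-covering number of a set of reals. -/
def covNum1 (δ : ℝ) (A : Set ℝ) : ℕ :=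
  Nat.card {k : ℤ | (Set.Ico ((k : ℝ) * δ) (((k : ℝ) + 1) * δ) ∩ A).Nonempty}

/-- `A` is a `(δ, s, C)`-set in the plane. -/
def IsDSSet (δ s C : ℝ) (A : Set (ℝ × ℝ)) : Prop :=
  ∀ (x : ℝ × ℝ) (r : ℝ), δ ≤ r → r ≤ 1 →
    (covNum δ (A ∩ Metric.ball x r) : ℝ) ≤ C * r ^ s * (covNum δ A : ℝ)

/-- The line `y = a x + b`, dual to the point `(a, b)`. -/
def dualLine (a b : ℝ) : Set (ℝ × ℝ) := {z : ℝ × ℝ | z.2 = a * z.1 + b}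

/-- The dyadic `δ`-tube `D(p)`, the union of the lines dual to points of the
dyadic `δ`-square with index `q`. -/
def dTube (δ : ℝ) (q : ℤ × ℤ) : Set (ℝ × ℝ) :=
  {z : ℝ × ℝ | ∃ ab ∈ dSq δ q, z.2 = ab.1 * z.1 + ab.2}

/-- The dyadic square with index `q` is contained in `[0,1)²`. -/
def sqInUnit (δ : ℝ) (q : ℤ × ℤ) : Prop :=
  dSq δ q ⊆ Set.Ico (0 : ℝ) 1 ×ˢ Set.Ico (0 : ℝ) 1

/-- The dyadic `δ`-square with index `q` is contained in `[−1,1] × ℝ`, so that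
`dTube δ q` is a legitimate dyadic `δ`-tube. -/
def tubeIdx (δ : ℝ) (q : ℤ × ℤ) : Prop :=
  (-1 : ℝ) ≤ (q.1 : ℝ) * δ ∧ ((q.1 : ℝ) + 1) * δ ≤ 1

/-- Index of the dyadic parent square/tube, when the scale is multiplied by `S`. -/
def parQ (S : ℤ) (q : ℤ × ℤ) : ℤ × ℤ := (Int.fdiv q.1 S, Int.fdiv q.2 S)

/-- The `c·ρ`-neighbourhood of the dyadic `ρ`-tube with index `q`; `c = 6` gives `6T`
and `c = 4` gives `4T`. -/
def nbTube (c ρ : ℝ) (q : ℤ × ℤ) : Set (ℝ × ℝ) :=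
  Metric.cthickening (c * ρ) (dTube ρ q)

/-- The union of the dyadic `δ`-squares indexed by a finite set. -/
def sqUnion (δ : ℝ) (P : Finset (ℤ × ℤ)) : Set (ℝ × ℝ) := ⋃ p ∈ P, dSq δ p

/-- `(𝒫, 𝒯)` is a `(δ, s, C, M)`-nice configuration: every `p ∈ 𝒫` carries a
`(δ, s, C)`-set `𝒯(p) ⊆ 𝒯` of tubes meeting `p`, with `|𝒯(p)| ∼ M`. -/
def NiceConfig (δ s C : ℝ) (M : ℕ) (P T : Finset (ℤ × ℤ))
    (Tp : ℤ × ℤ → Finset (ℤ × ℤ)) : Prop :=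
  (∀ p ∈ P, sqInUnit δ p) ∧ (∀ t ∈ T, tubeIdx δ t) ∧
  ∀ p ∈ P, Tp p ⊆ T ∧ IsDSSet δ s C (sqUnion δ (Tp p)) ∧
    (M : ℝ) ≤ 2 * ((Tp p).card : ℝ) ∧ ((Tp p).card : ℝ) ≤ 2 * (M : ℝ) ∧
    ∀ t ∈ Tp p, (dTube δ t ∩ dSq δ p).Nonempty

/-! ### A mean-zero kernel and its autocorrelation -/

/-- The difference of the indicators of the intervals with endpoints `±w` and `±w'`,
each divided by its half-length. -/
def bumpDiff (w w' u : ℝ) : ℝ :=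
  (Icc (-w) w).indicator (fun _ => 1 / w) u - (Icc (-w') w').indicator (fun _ => 1 / w') u

/-- The autocorrelation of `bumpDiff`. -/
def bumpCorr (w w' u : ℝ) : ℝ := ∫ b, bumpDiff w w' b * bumpDiff w w' (u - b)

/-- A Lipschitz weight that is at least `1` on `[-2, 2]` and supported in `[-3, 3]`. -/
def tent (a : ℝ) : ℝ := max 0 (3 - |a|)

theorem tent_nonneg (a : ℝ) : 0 ≤ tent a := le_max_left _ _

theorem tent_le (a : ℝ) : tent a ≤ 3 := by
  unfold tent
  exact max_le (by norm_num) (by linarith [abs_nonneg a])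

theorem one_le_tent {a : ℝ} (h : |a| ≤ 2) : 1 ≤ tent a :=
  le_max_of_le_right (by linarith)

theorem tent_eq_zero {a : ℝ} (h : 3 < |a|) : tent a = 0 :=
  max_eq_left (by linarith)

theorem abs_tent_sub_le (a b : ℝ) : |tent a - tent b| ≤ |a - b| := by
  unfold tent
  rw [max_comm 0, max_comm 0]
  refine (abs_max_sub_max_le_abs _ _ _).trans ?_ |>.trans (abs_abs_sub_abs_le_abs_sub b a) |>.trans
    (le_of_eq (abs_sub_comm _ _))
  exact le_of_eq (by congr 1; ring)

theorem continuous_tent : Continuous tent := by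
  unfold tent
  fun_prop

theorem bumpDiff_neg (w w' u : ℝ) : bumpDiff w w' (-u) = bumpDiff w w' u := by
  unfold bumpDiff
  congr 1 <;>
  · simp only [indicator, mem_Icc]
    congr 1
    exact propext ⟨fun h => ⟨by linarith, by linarith⟩, fun h => ⟨by linarith, by linarith⟩⟩

theorem measurable_bumpDiff (w w' : ℝ) : Measurable (bumpDiff w w') :=
  (measurable_const.indicator measurableSet_Icc).sub (measurable_const.indicator measurableSet_Icc)

theorem integrable_bumpDiff (w w' : ℝ) : MeasureTheory.Integrable (bumpDiff w w') := by
  refine MeasureTheory.Integrable.sub ?_ ?_ <;>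
  · refine MeasureTheory.IntegrableOn.integrable_indicator ?_ measurableSet_Icc
    exact MeasureTheory.integrableOn_const (by simp) 

theorem integral_indicator_bump {w : ℝ} (hw : 0 < w) :
    ∫ u, (Icc (-w) w).indicator (fun _ => 1 / w) u = 2 := by
  rw [MeasureTheory.integral_indicator measurableSet_Icc]
  simp [MeasureTheory.measureReal_def]
  rw [ENNReal.toReal_ofReal (by linarith)]
  field_simp
  norm_num

theorem integral_bumpDiff {w w' : ℝ} (hw : 0 < w) (hw' : 0 < w') :
    ∫ u, bumpDiff w w' u = 0 := by
  unfold bumpDiff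
  rw [MeasureTheory.integral_sub, integral_indicator_bump hw, integral_indicator_bump hw', sub_self]
  all_goals
    refine MeasureTheory.IntegrableOn.integrable_indicator ?_ measurableSet_Icc
    exact MeasureTheory.integrableOn_const (by simp)

theorem abs_bumpDiff_le {w w' : ℝ} (hw : 0 < w) (hww : w ≤ w') (u : ℝ) :
    |bumpDiff w w' u| ≤ 1 / w := by
  have h1 : 0 < 1 / w := by positivity
  have h2 : 0 < 1 / w' := by have := hw.trans_le hww; positivity
  have h3 : 1 / w' ≤ 1 / w := one_div_le_one_div_of_le hw hww
  unfold bumpDiff indicator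
  rw [abs_le]
  split_ifs <;> constructor <;> linarith

theorem integral_abs_bumpDiff_le {w w' : ℝ} (hw : 0 < w) (hww : w ≤ w') :
    ∫ u, |bumpDiff w w' u| ≤ 4 := by
  have hw' := hw.trans_le hww
  have hi : ∀ v : ℝ, MeasureTheory.Integrable ((Icc (-v) v).indicator (fun _ : ℝ => 1 / v)) :=
    fun v => (MeasureTheory.integrableOn_const (by simp)).integrable_indicator measurableSet_Icc
  calc ∫ u, |bumpDiff w w' u|
      ≤ ∫ u, ((Icc (-w) w).indicator (fun _ => 1 / w) u
          + (Icc (-w') w').indicator (fun _ => 1 / w') u) := by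
        refine MeasureTheory.integral_mono (integrable_bumpDiff w w').abs ((hi w).add (hi w')) ?_
        intro u
        have h1 : 0 < 1 / w := by positivity
        have h2 : 0 < 1 / w' := by positivity
        simp only [bumpDiff, indicator]
        rw [abs_le]
        split_ifs <;> constructor <;> linarith
    _ = 4 := by
        rw [MeasureTheory.integral_add (hi w) (hi w'), integral_indicator_bump hw,
          integral_indicator_bump hw']
        norm_num

theorem abs_bumpCorr_le {w w' : ℝ} (hw : 0 < w) (hww : w ≤ w') (u : ℝ) :
    |bumpCorr w w' u| ≤ 4 / w := by
  have h := MeasureTheory.norm_integral_le_of_norm_le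
    (f := fun b => bumpDiff w w' b * bumpDiff w w' (u - b))
    (g := fun b => |bumpDiff w w' b| * (1 / w)) (μ := MeasureTheory.volume)
    ((integrable_bumpDiff w w').abs.mul_const _)
    (Filter.Eventually.of_forall fun b => by
      simp only [Real.norm_eq_abs, abs_mul]
      exact mul_le_mul_of_nonneg_left (abs_bumpDiff_le hw hww _) (abs_nonneg _))
  rw [MeasureTheory.integral_mul_const] at h
  refine h.trans ?_
  calc _ ≤ 4 * (1 / w) := mul_le_mul_of_nonneg_right (integral_abs_bumpDiff_le hw hww) (by positivity)
    _ = _ := by ring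

theorem bumpDiff_eq_zero {w w' u : ℝ} (hww : w ≤ w') (hu : w' < |u|) : bumpDiff w w' u = 0 := by
  unfold bumpDiff
  rw [indicator_of_notMem, indicator_of_notMem, sub_self]
  · rw [mem_Icc, ← abs_le]; linarith
  · rw [mem_Icc, ← abs_le]; linarith

theorem bumpCorr_eq_zero {w w' u : ℝ} (hww : w ≤ w') (hu : 2 * w' < |u|) :
    bumpCorr w w' u = 0 := by
  unfold bumpCorr
  refine MeasureTheory.integral_eq_zero_of_ae (Filter.Eventually.of_forall fun b => ?_)
  rcases lt_or_ge w' |b| with h | h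
  · simp [bumpDiff_eq_zero hww h]
  · have : w' < |u - b| := by
      have := abs_sub_abs_le_abs_sub u b
      linarith
    simp [bumpDiff_eq_zero hww this]

theorem bumpCorr_eq_convolution (w w' : ℝ) :
    bumpCorr w w' = MeasureTheory.convolution (bumpDiff w w') (bumpDiff w w')
      (ContinuousLinearMap.mul ℝ ℝ) MeasureTheory.volume := by
  ext u
  simp [bumpCorr, MeasureTheory.convolution]

theorem integrable_bumpCorr (w w' : ℝ) : MeasureTheory.Integrable (bumpCorr w w') := by
  rw [bumpCorr_eq_convolution]
  exact (integrable_bumpDiff w w').integrable_convolution _ (integrable_bumpDiff w w')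

theorem integral_bumpCorr {w w' : ℝ} (hw : 0 < w) (hw' : 0 < w') :
    ∫ u, bumpCorr w w' u = 0 := by
  rw [bumpCorr_eq_convolution, MeasureTheory.integral_convolution _ (integrable_bumpDiff w w')
    (integrable_bumpDiff w w'), integral_bumpDiff hw hw']
  simp

theorem measurable_bumpCorr (w w' : ℝ) : Measurable (bumpCorr w w') := by
  have : MeasureTheory.StronglyMeasurable (bumpCorr w w') := by
    unfold bumpCorr
    refine MeasureTheory.StronglyMeasurable.integral_prod_right
      (f := fun u b => bumpDiff w w' b * bumpDiff w w' (u - b)) ?_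
    refine Measurable.stronglyMeasurable ?_
    exact ((measurable_bumpDiff w w').comp measurable_snd).mul
      ((measurable_bumpDiff w w').comp (measurable_fst.sub measurable_snd))
  exact this.measurable

theorem integrable_tent_mul_bumpCorr {w w' : ℝ} (hw : 0 < w) (hww : w ≤ w') (x y : ℝ) :
    MeasureTheory.Integrable fun a => tent a * bumpCorr w w' (y - a * x) := by
  have h1 : MeasureTheory.Integrable tent := by
    refine continuous_tent.integrable_of_hasCompactSupport ?_
    refine HasCompactSupport.intro (isCompact_Icc (a := (-3 : ℝ)) (b := 3)) fun a ha => ?_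
    refine tent_eq_zero ?_
    by_contra h
    exact ha (abs_le.1 (not_lt.1 h))
  refine h1.mul_bdd (c := 4 / w) ?_ (Filter.Eventually.of_forall fun a => abs_bumpCorr_le hw hww _)
  exact ((measurable_bumpCorr w w').comp (by fun_prop)).aestronglyMeasurable

theorem integral_le_of_support {f : ℝ → ℝ} {x0 r C : ℝ} (hr : 0 ≤ r)
    (h0 : ∀ a, r < |a - x0| → f a = 0) (hC : ∀ a, |a - x0| ≤ r → |f a| ≤ C) :
    ∫ a, f a ≤ C * (2 * r) := by
  rw [← MeasureTheory.setIntegral_eq_integral_of_forall_compl_eq_zero (s := Icc (x0 - r) (x0 + r))]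
  · refine (le_abs_self _).trans ?_
    have := MeasureTheory.norm_setIntegral_le_of_norm_le_const (μ := MeasureTheory.volume)
      (s := Icc (x0 - r) (x0 + r)) (f := f) (C := C) (by simp) (fun a ha => hC a ?_)
    · refine this.trans (le_of_eq ?_)
      rw [MeasureTheory.measureReal_def, Real.volume_Icc, ENNReal.toReal_ofReal (by linarith)]
      ring
    · rw [abs_le]; constructor <;> linarith [ha.1, ha.2]
  · intro a ha
    refine h0 a ?_
    by_contra h
    rw [not_lt, abs_le] at h
    exact ha ⟨by linarith, by linarith⟩

theorem integral_tent_mul_bumpCorr_le_trivial {w w' : ℝ} (hw : 0 < w) (hww : w ≤ w') (x y : ℝ) :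
    ∫ a, tent a * bumpCorr w w' (y - a * x) ≤ 72 / w := by
  refine (integral_le_of_support (x0 := 0) (r := 3) (C := 3 * (4 / w)) (by norm_num) ?_ ?_).trans
    (le_of_eq (by ring))
  · intro a ha
    rw [sub_zero] at ha
    rw [tent_eq_zero ha, zero_mul]
  · intro a _
    rw [abs_mul, abs_of_nonneg (tent_nonneg a)]
    exact mul_le_mul (tent_le a) (abs_bumpCorr_le hw hww _) (abs_nonneg _) (by norm_num)

theorem integral_tent_mul_bumpCorr_le_transverse {w w' : ℝ} (hw : 0 < w) (hww : w ≤ w')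
    {x : ℝ} (hx : x ≠ 0) (y : ℝ) :
    ∫ a, tent a * bumpCorr w w' (y - a * x) ≤ 32 * w' ^ 2 / (w * x ^ 2) := by
  have hw' := hw.trans_le hww
  have hi : MeasureTheory.Integrable fun a => bumpCorr w w' (y - a * x) := by
    have := ((integrable_bumpCorr w w').comp_sub_left y).comp_mul_right' hx
    exact this
  have h0 : ∫ a, bumpCorr w w' (y - a * x) = 0 := by
    have := MeasureTheory.Measure.integral_comp_mul_right (fun a => bumpCorr w w' (y - a)) x
    rw [this, MeasureTheory.integral_sub_left_eq_self (bumpCorr w w') MeasureTheory.volume y,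
      integral_bumpCorr hw hw', smul_zero]
  have e : ∫ a, tent a * bumpCorr w w' (y - a * x)
      = ∫ a, (tent a - tent (y / x)) * bumpCorr w w' (y - a * x) := by
    simp only [sub_mul]
    rw [MeasureTheory.integral_sub (integrable_tent_mul_bumpCorr hw hww x y) (hi.const_mul _),
      MeasureTheory.integral_const_mul, h0]
    simp
  have hxa : 0 < |x| := abs_pos.2 hx
  rw [e]
  refine (integral_le_of_support (x0 := y / x) (r := 2 * w' / |x|) (C := 2 * w' / |x| * (4 / w))
    (by positivity) ?_ ?_).trans (le_of_eq ?_)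
  · intro a ha
    rw [bumpCorr_eq_zero hww, mul_zero]
    rw [div_lt_iff₀ hxa, ← abs_mul] at ha
    rw [← abs_neg]
    have e : -(y - a * x) = (a - y / x) * x := by field_simp; ring
    rwa [e]
  · intro a ha
    rw [abs_mul]
    exact mul_le_mul ((abs_tent_sub_le _ _).trans ha) (abs_bumpCorr_le hw hww _) (abs_nonneg _)
      (by positivity)
  · rw [← sq_abs x]
    field_simp
    ring

theorem integral_tent_mul_bumpCorr_le {w w' : ℝ} (hw : 0 < w) (hww : w ≤ w') (x y : ℝ) :
    ∫ a, tent a * bumpCorr w w' (y - a * x)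
      ≤ 1152 * (w' / w) ^ 2 * (w / max (max |x| |y|) w ^ 2) := by
  have hw' := hw.trans_le hww
  set d := max |x| |y| with hd
  have hone : 1 ≤ w' / w := (one_le_div hw).2 hww
  rcases le_or_gt d w with hdw | hdw
  · rw [max_eq_right hdw]
    refine (integral_tent_mul_bumpCorr_le_trivial hw hww x y).trans ?_
    have e : 1152 * (w' / w) ^ 2 * (w / w ^ 2) = (1152 * (w' / w) ^ 2) / w := by field_simp
    rw [e]
    gcongr
    nlinarith
  have hd0 := hw.trans hdw
  rw [max_eq_left hdw.le]
  have e : 1152 * (w' / w) ^ 2 * (w / d ^ 2) = 1152 * w' ^ 2 / (w * d ^ 2) := by field_simp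
  rw [e]
  rcases le_or_gt (d / 6) |x| with hx | hx
  · have hx0 : x ≠ 0 := by
      rintro rfl
      rw [abs_zero] at hx
      linarith
    refine (integral_tent_mul_bumpCorr_le_transverse hw hww hx0 y).trans ?_
    rw [div_le_div_iff₀ (by positivity) (by positivity)]
    have : d ^ 2 ≤ 36 * x ^ 2 := by
      rw [← sq_abs x]
      nlinarith
    have h2 : 0 ≤ w' ^ 2 * w := by positivity
    nlinarith
  · have hy : |y| = d := by
      rcases max_cases |x| |y| with h | h
      · rw [← hd] at h; linarith
      · exact h.1.symm
    rcases le_or_gt d (4 * w') with h4 | h4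
    · refine (integral_tent_mul_bumpCorr_le_trivial hw hww x y).trans ?_
      rw [div_le_div_iff₀ (by positivity) (by positivity)]
      have : d ^ 2 ≤ 16 * w' ^ 2 := by nlinarith
      nlinarith
    · have : ∀ a, tent a * bumpCorr w w' (y - a * x) = 0 := by
        intro a
        rcases lt_or_ge 3 |a| with ha | ha
        · rw [tent_eq_zero ha, zero_mul]
        · rw [bumpCorr_eq_zero hww, mul_zero]
          have h1 := abs_sub_abs_le_abs_sub y (a * x)
          rw [abs_mul] at h1
          have : |a| * |x| ≤ 3 * (d / 6) := mul_le_mul ha hx.le (abs_nonneg _) (by norm_num)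
          linarith
      simp only [this, MeasureTheory.integral_zero]
      positivity

theorem integrable_bumpDiff_mul {w w' : ℝ} (hw : 0 < w) (hww : w ≤ w') (u v : ℝ) :
    MeasureTheory.Integrable fun b => bumpDiff w w' (u - b) * bumpDiff w w' (v - b) := by
  refine ((integrable_bumpDiff w w').comp_sub_left u).mul_bdd (c := 1 / w) ?_
    (Filter.Eventually.of_forall fun b => abs_bumpDiff_le hw hww _)
  exact ((measurable_bumpDiff w w').comp (by fun_prop)).aestronglyMeasurable

theorem integral_bumpDiff_mul (w w' u v : ℝ) :
    ∫ b, bumpDiff w w' (u - b) * bumpDiff w w' (v - b) = bumpCorr w w' (u - v) := by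
  unfold bumpCorr
  rw [← MeasureTheory.integral_sub_left_eq_self
    (fun b => bumpDiff w w' b * bumpDiff w w' (u - v - b)) MeasureTheory.volume u]
  congr 1
  ext b
  rw [← bumpDiff_neg w w' (v - b)]
  congr 2
  ring

theorem sq_sum_bumpDiff {ι : Type*} (X : Finset ι) (w w' : ℝ) (f : ι → ℝ) (b : ℝ) :
    (∑ q ∈ X, bumpDiff w w' (f q - b)) ^ 2
      = ∑ p ∈ X, ∑ q ∈ X, bumpDiff w w' (f p - b) * bumpDiff w w' (f q - b) := by
  rw [sq, Finset.sum_mul_sum]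

theorem integrable_sq_sum_bumpDiff {ι : Type*} (X : Finset ι) {w w' : ℝ} (hw : 0 < w)
    (hww : w ≤ w') (f : ι → ℝ) :
    MeasureTheory.Integrable fun b => (∑ q ∈ X, bumpDiff w w' (f q - b)) ^ 2 := by
  simp only [sq_sum_bumpDiff]
  exact MeasureTheory.integrable_finsetSum _ fun p _ => MeasureTheory.integrable_finsetSum _
    fun q _ => integrable_bumpDiff_mul hw hww _ _

theorem integral_sq_sum_bumpDiff {ι : Type*} (X : Finset ι) {w w' : ℝ} (hw : 0 < w)
    (hww : w ≤ w') (f : ι → ℝ) :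
    ∫ b, (∑ q ∈ X, bumpDiff w w' (f q - b)) ^ 2
      = ∑ p ∈ X, ∑ q ∈ X, bumpCorr w w' (f p - f q) := by
  simp only [sq_sum_bumpDiff]
  rw [MeasureTheory.integral_finsetSum _ fun p _ => MeasureTheory.integrable_finsetSum _
    fun q _ => integrable_bumpDiff_mul hw hww _ _]
  refine Finset.sum_congr rfl fun p _ => ?_
  rw [MeasureTheory.integral_finsetSum _ fun q _ => integrable_bumpDiff_mul hw hww _ _]
  exact Finset.sum_congr rfl fun q _ => integral_bumpDiff_mul _ _ _ _

theorem integrable_indicator_Icc (l r c : ℝ) :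
    MeasureTheory.Integrable ((Icc l r).indicator fun _ => c) :=
  (MeasureTheory.integrableOn_const (by simp)).integrable_indicator measurableSet_Icc

theorem integral_indicator_Icc {l r : ℝ} (h : l ≤ r) (c : ℝ) :
    ∫ u, (Icc l r).indicator (fun _ => c) u = (r - l) * c := by
  rw [MeasureTheory.integral_indicator measurableSet_Icc, MeasureTheory.setIntegral_const,
    MeasureTheory.measureReal_def, Real.volume_Icc, ENNReal.toReal_ofReal (by linarith), smul_eq_mul]

/-- If a family of parallelograms in the dual plane has overlap controlled by the square of the
mean-zero line-counting function of `X`, then its total area is controlled by the energy of `X`. -/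
theorem card_mul_area_le_energy {ι : Type*} (X : Finset (ℤ × ℤ)) (E : Finset ι) (ae be : ι → ℝ)
    {x0 α β c w w' : ℝ} (hw : 0 < w) (hww : w ≤ w') (hα : 0 < α) (hα1 : α ≤ 1) (hβ : 0 < β)
    (hae : ∀ e ∈ E, |ae e| ≤ 1)
    (h : ∀ a b : ℝ, |a| ≤ 2 →
      c * ((E.filter fun e => |a - ae e| ≤ α ∧ |b + (a - ae e) * x0 - be e| ≤ β).card : ℝ)
        ≤ (∑ q ∈ X, bumpDiff w w' (((q.2 : ℝ) - a * q.1) - b)) ^ 2) :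
    c * (E.card : ℝ) * (4 * α * β) ≤ 1152 * (w' / w) ^ 2 *
      ∑ p ∈ X, ∑ q ∈ X, w / max (max |(p.1 : ℝ) - q.1| |(p.2 : ℝ) - q.2|) w ^ 2 := by
  set G : ℝ → ℝ := fun a => ∑ p ∈ X, ∑ q ∈ X,
    bumpCorr w w' (((p.2 : ℝ) - q.2) - a * ((p.1 : ℝ) - q.1)) with hG
  have hGint : ∀ a, ∫ b, (∑ q ∈ X, bumpDiff w w' (((q.2 : ℝ) - a * q.1) - b)) ^ 2 = G a := by
    intro a
    rw [integral_sq_sum_bumpDiff X hw hww fun q => ((q.2 : ℝ) - a * q.1)]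
    refine Finset.sum_congr rfl fun p _ => Finset.sum_congr rfl fun q _ => ?_
    congr 1
    ring
  have hG0 : ∀ a, 0 ≤ G a := fun a => by
    rw [← hGint]
    exact MeasureTheory.integral_nonneg fun b => sq_nonneg _
  set L : ℝ → ℝ := fun a => ∑ e ∈ E, (Icc (ae e - α) (ae e + α)).indicator (fun _ => c * (2 * β)) a
    with hL
  have hLG : ∀ a, |a| ≤ 2 → L a ≤ G a := by
    intro a ha
    set m : ℝ → ℝ := fun b => ∑ e ∈ E.filter fun e => |a - ae e| ≤ α,
      (Icc (be e - (a - ae e) * x0 - β) (be e - (a - ae e) * x0 + β)).indicator (fun _ => c) b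
      with hm
    have hmi : MeasureTheory.Integrable m :=
      MeasureTheory.integrable_finsetSum _ fun e _ => integrable_indicator_Icc _ _ _
    have hmint : ∫ b, m b = L a := by
      rw [hm, MeasureTheory.integral_finsetSum _ fun e _ => integrable_indicator_Icc _ _ _, hL,
        Finset.sum_filter]
      refine Finset.sum_congr rfl fun e _ => ?_
      rw [integral_indicator_Icc (by linarith)]
      by_cases hh : |a - ae e| ≤ α
      · rw [if_pos hh, indicator_of_mem]
        · ring
        · rw [abs_le] at hh; exact ⟨by linarith, by linarith⟩
      · rw [if_neg hh, indicator_of_notMem]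
        intro h'
        exact hh (abs_le.2 ⟨by linarith [h'.1], by linarith [h'.2]⟩)
    rw [← hmint, ← hGint]
    refine MeasureTheory.integral_mono hmi (integrable_sq_sum_bumpDiff X hw hww _) fun b => ?_
    refine le_trans (le_of_eq ?_) (h a b ha)
    simp only [hm, indicator]
    rw [← Finset.sum_filter, Finset.filter_filter, Finset.sum_const, nsmul_eq_mul, mul_comm]
    congr 3
    ext e
    simp only [Finset.mem_filter, mem_Icc, abs_le]
    constructor
    · rintro ⟨h1, h2, h3, h4⟩
      exact ⟨h1, h2, by linarith, by linarith⟩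
    · rintro ⟨h1, h2, h3, h4⟩
      exact ⟨h1, h2, by linarith, by linarith⟩
  have hLi : MeasureTheory.Integrable L :=
    MeasureTheory.integrable_finsetSum _ fun e _ => integrable_indicator_Icc _ _ _
  have hLint : ∫ a, L a = c * (E.card : ℝ) * (4 * α * β) := by
    rw [hL, MeasureTheory.integral_finsetSum _ fun e _ => integrable_indicator_Icc _ _ _]
    have : ∀ e ∈ E, ∫ a, (Icc (ae e - α) (ae e + α)).indicator (fun _ => c * (2 * β)) a
        = 4 * α * β * c := by
      intro e _
      rw [integral_indicator_Icc (by linarith)]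
      ring
    rw [Finset.sum_congr rfl this, Finset.sum_const, nsmul_eq_mul]
    ring
  have hTe : ∀ a, tent a * G a = ∑ p ∈ X, ∑ q ∈ X,
      tent a * bumpCorr w w' (((p.2 : ℝ) - q.2) - a * ((p.1 : ℝ) - q.1)) := by
    intro a
    simp only [hG, Finset.mul_sum]
  have hTi : MeasureTheory.Integrable fun a => tent a * G a := by
    simp only [hTe]
    exact MeasureTheory.integrable_finsetSum _ fun p _ => MeasureTheory.integrable_finsetSum _
      fun q _ => integrable_tent_mul_bumpCorr hw hww _ _
  rw [← hLint]
  calc ∫ a, L a ≤ ∫ a, tent a * G a := by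
        refine MeasureTheory.integral_mono hLi hTi fun a => ?_
        rcases le_or_gt |a| 2 with ha | ha
        · have h1 := hLG a ha
          have h2 := one_le_tent ha
          have h3 := hG0 a
          show L a ≤ tent a * G a
          nlinarith
        · have : L a = 0 := by
            refine Finset.sum_eq_zero fun e he => indicator_of_notMem ?_ _
            rintro ⟨h1, h2⟩
            have := abs_le.1 (hae e he)
            rcases lt_abs.1 ha with h | h <;> linarith
          show L a ≤ tent a * G a
          rw [this]
          exact mul_nonneg (tent_nonneg a) (hG0 a)
    _ = ∑ p ∈ X, ∑ q ∈ X, ∫ a, tent a *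
          bumpCorr w w' (((p.2 : ℝ) - q.2) - a * ((p.1 : ℝ) - q.1)) := by
        simp only [hTe]
        rw [MeasureTheory.integral_finsetSum _ fun p _ => MeasureTheory.integrable_finsetSum _
          fun q _ => integrable_tent_mul_bumpCorr hw hww _ _]
        exact Finset.sum_congr rfl fun p _ => MeasureTheory.integral_finsetSum _
          fun q _ => integrable_tent_mul_bumpCorr hw hww _ _
    _ ≤ ∑ p ∈ X, ∑ q ∈ X, 1152 * (w' / w) ^ 2 *
          (w / max (max |(p.1 : ℝ) - q.1| |(p.2 : ℝ) - q.2|) w ^ 2) :=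
        Finset.sum_le_sum fun p _ => Finset.sum_le_sum fun q _ =>
          integral_tent_mul_bumpCorr_le hw hww _ _
    _ = _ := by simp only [Finset.mul_sum]

/-- The number of points of `X` at vertical distance at most `w` from the line `y = a x + b`. -/
def lineCount (X : Finset (ℤ × ℤ)) (w a b : ℝ) : ℕ :=
  (X.filter fun q => |(q.2 : ℝ) - a * q.1 - b| ≤ w).card

theorem sum_bumpDiff_eq (X : Finset (ℤ × ℤ)) (w w' a b : ℝ) :
    ∑ q ∈ X, bumpDiff w w' (((q.2 : ℝ) - a * q.1) - b)
      = lineCount X w a b / w - lineCount X w' a b / w' := by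
  unfold lineCount bumpDiff
  rw [Finset.sum_sub_distrib]
  congr 1 <;>
  · simp only [indicator, mem_Icc, ← abs_le]
    rw [← Finset.sum_filter, Finset.sum_const, nsmul_eq_mul, mul_one_div]

/-! ### Grid cells and levels -/

/-- The index of the cell of side `S ^ i` containing `q`. -/
def cell (S i : ℕ) (q : ℤ × ℤ) : ℤ × ℤ := (q.1 / (S : ℤ) ^ i, q.2 / (S : ℤ) ^ i)

/-- The cells of side `S ^ i` containing `p` and `q` are equal or adjacent. -/
def Near (S i : ℕ) (p q : ℤ × ℤ) : Prop :=
  |(cell S i p).1 - (cell S i q).1| ≤ 1 ∧ |(cell S i p).2 - (cell S i q).2| ≤ 1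

/-- The sup-distance of two lattice points. -/
def supDist (p q : ℤ × ℤ) : ℝ := max |(p.1 : ℝ) - q.1| |(p.2 : ℝ) - q.2|

theorem cell_add (S i k : ℕ) (q : ℤ × ℤ) :
    cell S (i + k) q = ((cell S i q).1 / (S : ℤ) ^ k, (cell S i q).2 / (S : ℤ) ^ k) := by
  have h : (0 : ℤ) ≤ (S : ℤ) ^ i := by positivity
  simp only [cell, pow_add, Int.ediv_ediv_of_nonneg h]

theorem cell_eq_mono {S i j : ℕ} (hij : i ≤ j) {p q : ℤ × ℤ} (h : cell S i p = cell S i q) :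
    cell S j p = cell S j q := by
  obtain ⟨k, rfl⟩ := Nat.exists_eq_add_of_le hij
  rw [cell_add, cell_add, h]

theorem abs_ediv_sub_ediv_le_one {m u v : ℤ} (hm : 0 < m) (h : |u - v| ≤ 1) :
    |u / m - v / m| ≤ 1 := by
  rw [abs_le] at h ⊢
  have e : ∀ x : ℤ, (x + 1) / m ≤ x / m + 1 := fun x => by
    calc (x + 1) / m ≤ (x + 1 * m) / m := Int.ediv_le_ediv hm (by linarith)
      _ = x / m + 1 := Int.add_mul_ediv_right _ _ hm.ne'
  have h1 : u / m ≤ (v + 1) / m := Int.ediv_le_ediv hm (by linarith)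
  have h2 : v / m ≤ (u + 1) / m := Int.ediv_le_ediv hm (by linarith)
  have := e u
  have := e v
  constructor <;> linarith

theorem Near.mono {S i j : ℕ} (hS : 0 < S) (hij : i ≤ j) {p q : ℤ × ℤ} (h : Near S i p q) :
    Near S j p q := by
  obtain ⟨k, rfl⟩ := Nat.exists_eq_add_of_le hij
  have hm : (0 : ℤ) < (S : ℤ) ^ k := by positivity
  unfold Near
  rw [cell_add, cell_add]
  exact ⟨abs_ediv_sub_ediv_le_one hm h.1, abs_ediv_sub_ediv_le_one hm h.2⟩

theorem near_of_cell_eq {S i : ℕ} {p q : ℤ × ℤ} (h : cell S i p = cell S i q) : Near S i p q := by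
  simp [Near, h]

theorem Near.symm {S i : ℕ} {p q : ℤ × ℤ} (h : Near S i p q) : Near S i q p :=
  ⟨by rw [abs_sub_comm]; exact h.1, by rw [abs_sub_comm]; exact h.2⟩

theorem near_congr {S i : ℕ} {p p' : ℤ × ℤ} (h : cell S i p = cell S i p') (q : ℤ × ℤ) :
    Near S i p q ↔ Near S i p' q := by
  simp [Near, h]

theorem le_abs_sub_of_lt_abs_ediv {m u v : ℤ} (hm : 0 < m) (h : 1 < |u / m - v / m|) :
    m ≤ |u - v| := by
  have h1 := Int.mul_ediv_add_emod u m
  have h2 := Int.mul_ediv_add_emod v m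
  have h3 := Int.emod_nonneg u hm.ne'
  have h4 := Int.emod_nonneg v hm.ne'
  have h5 := Int.emod_lt_of_pos u hm
  have h6 := Int.emod_lt_of_pos v hm
  rw [lt_abs] at h
  rw [le_abs]
  rcases h with h | h
  · left; nlinarith
  · right; nlinarith

theorem le_supDist_of_not_near {S i : ℕ} (hS : 0 < S) {p q : ℤ × ℤ} (h : ¬ Near S i p q) :
    (S : ℝ) ^ i ≤ supDist p q := by
  have hm : (0 : ℤ) < (S : ℤ) ^ i := by positivity
  unfold Near at h
  rw [not_and_or, not_le, not_le] at h
  rcases h with h | h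
  · refine le_max_of_le_left ?_
    have := le_abs_sub_of_lt_abs_ediv hm h
    exact_mod_cast this
  · refine le_max_of_le_right ?_
    have := le_abs_sub_of_lt_abs_ediv hm h
    exact_mod_cast this

theorem near_of_mem_box {S J : ℕ} {p q : ℤ × ℤ}
    (hp : 0 ≤ p.1 ∧ p.1 < (S : ℤ) ^ J ∧ 0 ≤ p.2 ∧ p.2 < (S : ℤ) ^ J)
    (hq : 0 ≤ q.1 ∧ q.1 < (S : ℤ) ^ J ∧ 0 ≤ q.2 ∧ q.2 < (S : ℤ) ^ J) : Near S J p q := by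
  refine near_of_cell_eq ?_
  simp only [cell]
  rw [Int.ediv_eq_zero_of_lt hp.1 hp.2.1, Int.ediv_eq_zero_of_lt hp.2.2.1 hp.2.2.2,
    Int.ediv_eq_zero_of_lt hq.1 hq.2.1, Int.ediv_eq_zero_of_lt hq.2.2.1 hq.2.2.2]

/-- Among the levels `≥ j`, level `l` is the first one at which `p` and `q` are near. -/
def Shell (S j l : ℕ) (p q : ℤ × ℤ) : Prop :=
  Near S l p q ∧ (l = j ∨ ¬ Near S (l - 1) p q)

theorem exists_shell {S j i : ℕ} (hij : j ≤ i) {p q : ℤ × ℤ} (h : Near S i p q) :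
    ∃ l ∈ Finset.Icc j i, Shell S j l p q := by
  have hex : ∃ k, Near S (j + k) p q := ⟨i - j, by rwa [Nat.add_sub_cancel' hij]⟩
  refine ⟨j + Nat.find hex, ?_, Nat.find_spec hex, ?_⟩
  · have := Nat.find_min' hex (m := i - j) (by rwa [Nat.add_sub_cancel' hij])
    rw [Finset.mem_Icc]
    omega
  · rcases Nat.eq_zero_or_pos (Nat.find hex) with h0 | h0
    · left; omega
    · right
      have := Nat.find_min hex (m := Nat.find hex - 1) (by omega)
      rwa [← Nat.add_sub_assoc h0] at this

theorem Shell.le_supDist {S j l : ℕ} (hS : 0 < S) {p q : ℤ × ℤ} (h : Shell S j l p q) :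
    (S : ℝ) ^ l ≤ S * max (supDist p q) ((S : ℝ) ^ j) := by
  have hS1 : (1 : ℝ) ≤ S := by exact_mod_cast hS
  rcases h.2 with h | h
  · subst h
    have h1 : (S : ℝ) ^ l ≤ max (supDist p q) ((S : ℝ) ^ l) := le_max_right _ _
    have h2 : (0 : ℝ) < (S : ℝ) ^ l := by positivity
    nlinarith
  · have h1 := le_supDist_of_not_near hS h
    have h2 : (S : ℝ) ^ l ≤ S * (S : ℝ) ^ (l - 1) := by
      rw [← pow_succ']
      exact pow_le_pow_right₀ hS1 (by omega)
    refine h2.trans ?_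
    gcongr
    exact h1.trans (le_max_left _ _)

theorem sum_le_sum_shells {S j i : ℕ} (hij : j ≤ i) (X : Finset (ℤ × ℤ)) (p : ℤ × ℤ)
    (hX : ∀ q ∈ X, Near S i p q) (g : ℤ × ℤ → ℝ) (hg : ∀ q, 0 ≤ g q) :
    ∑ q ∈ X, g q ≤ ∑ l ∈ Finset.Icc j i, ∑ q ∈ X.filter (Shell S j l p), g q := by
  simp only [Finset.sum_filter]
  rw [Finset.sum_comm]
  refine Finset.sum_le_sum fun q hq => ?_
  obtain ⟨l, hl, hs⟩ := exists_shell hij (hX q hq)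
  have := Finset.single_le_sum (f := fun l => if Shell S j l p q then g q else 0)
    (fun l _ => by split_ifs <;> simp [hg]) hl
  simpa [hs] using this

theorem card_near_le {S i : ℕ} (X : Finset (ℤ × ℤ)) {B : ℝ} (hB : 0 ≤ B)
    (h : ∀ q ∈ X, ((X.filter fun q' => cell S i q' = cell S i q).card : ℝ) ≤ B) (p : ℤ × ℤ) :
    ((X.filter (Near S i p)).card : ℝ) ≤ 9 * B := by
  set c := cell S i p
  set box := Finset.Icc (c.1 - 1) (c.1 + 1) ×ˢ Finset.Icc (c.2 - 1) (c.2 + 1) with hbox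
  have hcard : box.card = 9 := by
    rw [hbox, Finset.card_product, Int.card_Icc, Int.card_Icc]
    have : ∀ x : ℤ, (x + 1 + 1 - (x - 1)).toNat = 3 := fun x => by
      rw [show x + 1 + 1 - (x - 1) = 3 by ring]; rfl
    rw [this, this]
  have hmaps : ∀ q ∈ X.filter (Near S i p), cell S i q ∈ box := by
    intro q hq
    obtain ⟨h1, h2⟩ := (Finset.mem_filter.1 hq).2
    rw [abs_le] at h1 h2
    rw [hbox, Finset.mem_product, Finset.mem_Icc, Finset.mem_Icc]
    refine ⟨⟨?_, ?_⟩, ?_, ?_⟩ <;> linarith [h1.1, h1.2, h2.1, h2.2]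
  rw [Finset.card_eq_sum_card_fiberwise hmaps]
  push_cast
  calc _ ≤ ∑ _b ∈ box, B := by
        refine Finset.sum_le_sum fun b _ => ?_
        rcases Finset.eq_empty_or_nonempty
          ((X.filter (Near S i p)).filter fun q => cell S i q = b) with he | ⟨q, hq⟩
        · rw [he]; simpa using hB
        · rw [Finset.mem_filter, Finset.mem_filter] at hq
          refine le_trans ?_ (h q hq.1.1)
          rw [hq.2]
          exact_mod_cast Finset.card_le_card
            (Finset.filter_subset_filter _ (Finset.filter_subset _ _))
    _ = 9 * B := by rw [Finset.sum_const, hcard, nsmul_eq_mul]; norm_num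

/-! ### Pigeonholing -/

theorem exists_card_le_card_mul_fiber {α β : Type*} (X : Finset α) (Y : Finset β)
    (hY : Y.Nonempty) (r : α → β → Prop) (h : ∀ x ∈ X, ∃ y ∈ Y, r x y) :
    ∃ y ∈ Y, X.card ≤ Y.card * (X.filter fun x => r x y).card := by
  by_contra hcon
  push Not at hcon
  have h1 : X.card ≤ ∑ y ∈ Y, (X.filter fun x => r x y).card := by
    simp only [Finset.card_filter]
    rw [Finset.sum_comm, Finset.card_eq_sum_ones]
    refine Finset.sum_le_sum fun x hx => ?_
    obtain ⟨y, hy, hr⟩ := h x hx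
    have := Finset.single_le_sum (f := fun y => if r x y then 1 else 0)
      (fun y _ => by split_ifs <;> simp) hy
    simpa [hr] using this
  have h2 : Y.card * ∑ y ∈ Y, (X.filter fun x => r x y).card < Y.card * X.card := by
    rw [Finset.mul_sum]
    calc _ < ∑ _y ∈ Y, X.card := Finset.sum_lt_sum_of_nonempty hY fun y hy => hcon y hy
      _ = _ := by rw [Finset.sum_const, smul_eq_mul]
  have := Nat.mul_le_mul_left Y.card h1
  omega

theorem exists_uniform_subset {S D : ℕ} (hD : 0 < D) (hS : 1 < S) (P : Finset (ℤ × ℤ))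
    (hP : P.card < S ^ D) (m : ℕ) :
    ∃ P' ⊆ P, P.card ≤ D ^ m * P'.card ∧ ∃ e : ℕ → ℕ, ∀ j < m, ∀ p ∈ P',
      S ^ e j ≤ (P'.filter fun q => cell S j q = cell S j p).card ∧
      (P'.filter fun q => cell S j q = cell S j p).card < S ^ (e j + 1) := by
  induction m with
  | zero => exact ⟨P, Finset.Subset.refl _, by simp, fun _ => 0, by simp⟩
  | succ m ih =>
    obtain ⟨P', hsub, hcard, e, he⟩ := ih
    set cnt : ℤ × ℤ → ℕ := fun p => (P'.filter fun q => cell S m q = cell S m p).card with hcnt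
    obtain ⟨y, -, hycard⟩ := exists_card_le_card_mul_fiber P' (Finset.range D)
      ⟨0, Finset.mem_range.2 hD⟩ (fun p y => Nat.log S (cnt p) = y) (by
        intro p hp
        refine ⟨_, Finset.mem_range.2 ?_, rfl⟩
        refine Nat.log_lt_of_lt_pow ?_ ?_
        · exact (Finset.card_pos.2 ⟨p, by simp [hp]⟩).ne'
        · exact ((Finset.card_le_card (Finset.filter_subset _ _)).trans
            (Finset.card_le_card hsub)).trans_lt hP)
    rw [Finset.card_range] at hycard
    set P'' := P'.filter fun p => Nat.log S (cnt p) = y with hP''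
    have hycard' : P'.card ≤ D * P''.card := by convert hycard
    have hsame : ∀ j ≤ m, ∀ p ∈ P'', (P''.filter fun q => cell S j q = cell S j p)
        = P'.filter fun q => cell S j q = cell S j p := by
      intro j hj p hp
      ext q
      simp only [hP'', Finset.mem_filter] at hp ⊢
      constructor
      · rintro ⟨⟨h1, h2⟩, h3⟩; exact ⟨h1, h3⟩
      · rintro ⟨h1, h3⟩
        refine ⟨⟨h1, ?_⟩, h3⟩
        have : cnt q = cnt p := by
          simp only [hcnt]
          rw [cell_eq_mono hj h3]
        rw [this, hp.2]
    refine ⟨P'', (Finset.filter_subset _ _).trans hsub, ?_, fun j => if j = m then y else e j, ?_⟩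
    · calc P.card ≤ D ^ m * P'.card := hcard
        _ ≤ D ^ m * (D * P''.card) := Nat.mul_le_mul_left _ hycard'
        _ = D ^ (m + 1) * P''.card := by ring
    · intro j hj p hp
      have hjm : j ≤ m := by omega
      rw [hsame j hjm p hp]
      have hp' : p ∈ P' := (Finset.mem_filter.1 hp).1
      by_cases hjm' : j = m
      · subst hjm'
        have hy := (Finset.mem_filter.1 hp).2
        have hpos : cnt p ≠ 0 := (Finset.card_pos.2 ⟨p, by simp [hp']⟩).ne'
        simp only [if_true]
        rw [← hy]
        exact ⟨Nat.pow_log_le_self S hpos, Nat.lt_pow_succ_log_self hS _⟩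
      · simp only [if_neg hjm']
        exact he j (by omega) p hp'

/-! ### Spaced configurations in integer coordinates -/

/-- The vertical distance from `q` to the line of slope `t.1 / N` and intercept `t.2`. -/
def resid (N : ℕ) (t q : ℤ × ℤ) : ℝ := (q.2 : ℝ) - (t.1 : ℝ) / N * q.1 - t.2

/-- A discretised configuration of `P` and `T` at resolution `1 / N`, rescaled to integer
coordinates, with the direction spacing, point spacing and cardinality conditions. -/
structure SpacedConfig (S J N : ℕ) (s K M : ℝ) (P T : Finset (ℤ × ℤ))
    (Tp : ℤ × ℤ → Finset (ℤ × ℤ)) : Prop where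
  two_le : 2 ≤ S
  N_pos : 0 < N
  N_le : N ≤ S ^ J
  le_N : S ^ J ≤ S * N
  s_pos : 0 < s
  s_le : s ≤ 1
  one_le_K : 1 ≤ K
  M_pos : 0 < M
  nonempty : P.Nonempty
  box : ∀ p ∈ P, 0 ≤ p.1 ∧ p.1 < N ∧ 0 ≤ p.2 ∧ p.2 < N
  subset : ∀ p ∈ P, Tp p ⊆ T
  slope : ∀ p ∈ P, ∀ t ∈ Tp p, |(t.1 : ℝ)| ≤ N
  incident : ∀ p ∈ P, ∀ t ∈ Tp p, |resid N t p| ≤ 4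
  direction : ∀ p ∈ P, ∀ a ρ : ℝ, 1 ≤ ρ →
    (((Tp p).filter fun t => |(t.1 : ℝ) - a| ≤ ρ).card : ℝ) ≤ K * (ρ / N) ^ s * M
  card_tubes : ∀ p ∈ P, M / 2 ≤ ((Tp p).card : ℝ)
  spacing : ∀ p ∈ P, ∀ i ≤ J, ((P.filter fun q => cell S i q = cell S i p).card : ℝ) ≤
    K * max (((S : ℝ) ^ i / N) ^ (2 - s) * P.card) (((S : ℝ) ^ i) ^ s)
  card_le : (P.card : ℝ) ≤ 2 * (N : ℝ) ^ (2 - s)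
  le_card : (N : ℝ) ^ s ≤ 2 * P.card

/-- The scales at which the second term of the spacing condition dominates. -/
def SmallScale (S N : ℕ) (s : ℝ) (P : Finset (ℤ × ℤ)) (i : ℕ) : Prop :=
  ((S : ℝ) ^ i) ^ (2 - 2 * s) * P.card ≤ 2 * (N : ℝ) ^ (2 - s)

theorem card_cell_le_of_card_cell_le {S j l : ℕ} (hS : 0 < S) (hjl : j ≤ l) (X : Finset (ℤ × ℤ))
    {B : ℝ} (hB : 0 ≤ B)
    (h : ∀ q ∈ X, ((X.filter fun q' => cell S j q' = cell S j q).card : ℝ) ≤ B) (p : ℤ × ℤ) :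
    ((X.filter fun q => cell S l q = cell S l p).card : ℝ)
      ≤ ((S : ℝ) ^ l / (S : ℝ) ^ j) ^ 2 * B := by
  obtain ⟨k, rfl⟩ := Nat.exists_eq_add_of_le hjl
  set c := cell S (j + k) p with hc
  set m : ℤ := (S : ℤ) ^ k with hm
  have hm0 : 0 < m := by positivity
  set box := Finset.Ico (c.1 * m) (c.1 * m + m) ×ˢ Finset.Ico (c.2 * m) (c.2 * m + m) with hbox
  have hcard : (box.card : ℝ) = ((S : ℝ) ^ (j + k) / (S : ℝ) ^ j) ^ 2 := by
    have hSne : (S : ℝ) ≠ 0 := by positivity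
    rw [pow_add, mul_div_cancel_left₀ _ (pow_ne_zero _ hSne), hbox, Finset.card_product,
      Int.card_Ico, Int.card_Ico]
    have : ∀ x : ℤ, ((x + m - x).toNat : ℝ) = (S : ℝ) ^ k := fun x => by
      rw [add_sub_cancel_left, hm, ← Nat.cast_pow, Int.toNat_natCast, Nat.cast_pow]
    rw [Nat.cast_mul, this, this, sq]
  have hmaps : ∀ q ∈ X.filter (fun q => cell S (j + k) q = c), cell S j q ∈ box := by
    intro q hq
    have h1 := (Finset.mem_filter.1 hq).2
    rw [cell_add] at h1
    rw [hbox, Finset.mem_product, Finset.mem_Ico, Finset.mem_Ico, ← h1]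
    have h2 := fun x : ℤ => Int.mul_ediv_add_emod x m
    have h3 := fun x : ℤ => Int.emod_nonneg x hm0.ne'
    have h4 := fun x : ℤ => Int.emod_lt_of_pos x hm0
    refine ⟨⟨?_, ?_⟩, ?_, ?_⟩
    · linarith [h2 (cell S j q).1, h3 (cell S j q).1]
    · linarith [h2 (cell S j q).1, h4 (cell S j q).1]
    · linarith [h2 (cell S j q).2, h3 (cell S j q).2]
    · linarith [h2 (cell S j q).2, h4 (cell S j q).2]
  rw [Finset.card_eq_sum_card_fiberwise hmaps]
  push_cast
  calc _ ≤ ∑ _b ∈ box, B := by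
        refine Finset.sum_le_sum fun b _ => ?_
        rcases Finset.eq_empty_or_nonempty
          ((X.filter fun q => cell S (j + k) q = c).filter fun q => cell S j q = b) with he | ⟨q, hq⟩
        · rw [he]; simpa using hB
        · rw [Finset.mem_filter, Finset.mem_filter] at hq
          refine le_trans ?_ (h q hq.1.1)
          rw [hq.2]
          exact_mod_cast Finset.card_le_card
            (Finset.filter_subset_filter _ (Finset.filter_subset _ _))
    _ = _ := by rw [Finset.sum_const, nsmul_eq_mul, hcard]

theorem supDist_nonneg (p q : ℤ × ℤ) : 0 ≤ supDist p q := le_max_of_le_left (abs_nonneg _)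

theorem energy_le {S j J : ℕ} (hS : 0 < S) (hj : j ≤ J) (X : Finset (ℤ × ℤ)) (p : ℤ × ℤ)
    (hX : ∀ q ∈ X, Near S J p q) {B : ℝ}
    (hB : ∀ l, j ≤ l → l ≤ J → (S : ℝ) ^ j / ((S : ℝ) ^ l) ^ 2 *
      ((X.filter (Near S l p)).card : ℝ) ≤ B) :
    ∑ q ∈ X, (S : ℝ) ^ j / max (supDist p q) ((S : ℝ) ^ j) ^ 2 ≤ (J + 1) * (S : ℝ) ^ 2 * B := by
  have hS0 : (0 : ℝ) < S := by exact_mod_cast hS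
  have hB0 : 0 ≤ B := le_trans (by positivity) (hB j le_rfl hj)
  refine (sum_le_sum_shells hj X p hX _ fun q => by positivity).trans ?_
  calc _ ≤ ∑ _l ∈ Finset.Icc j J, (S : ℝ) ^ 2 * B := by
        refine Finset.sum_le_sum fun l hl => ?_
        rw [Finset.mem_Icc] at hl
        calc _ ≤ ∑ q ∈ X.filter (Shell S j l p),
              (S : ℝ) ^ 2 * ((S : ℝ) ^ j / ((S : ℝ) ^ l) ^ 2) := by
              refine Finset.sum_le_sum fun q hq => ?_
              have h1 := (Finset.mem_filter.1 hq).2.le_supDist hS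
              have h2 : 0 < max (supDist p q) ((S : ℝ) ^ j) := lt_max_of_lt_right (by positivity)
              rw [mul_div_assoc', div_le_div_iff₀ (by positivity) (by positivity)]
              have h3 : ((S : ℝ) ^ l) ^ 2 ≤ (S * max (supDist p q) ((S : ℝ) ^ j)) ^ 2 := by gcongr
              rw [mul_pow] at h3
              have h4 : (0 : ℝ) < (S : ℝ) ^ j := by positivity
              nlinarith
          _ = (S : ℝ) ^ 2 * ((S : ℝ) ^ j / ((S : ℝ) ^ l) ^ 2 *
                ((X.filter (Shell S j l p)).card : ℝ)) := by
              rw [Finset.sum_const, nsmul_eq_mul]; ring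
          _ ≤ (S : ℝ) ^ 2 * B := by
              refine mul_le_mul_of_nonneg_left (le_trans ?_ (hB l hl.1 hl.2)) (by positivity)
              refine mul_le_mul_of_nonneg_left ?_ (by positivity)
              refine Nat.cast_le.2 (Finset.card_le_card fun q hq => ?_)
              rw [Finset.mem_filter] at hq ⊢
              exact ⟨hq.1, hq.2.1⟩
    _ = ((J + 1 - j : ℕ) : ℝ) * ((S : ℝ) ^ 2 * B) := by
        rw [Finset.sum_const, nsmul_eq_mul, Nat.card_Icc]
    _ ≤ ((J + 1 : ℕ) : ℝ) * ((S : ℝ) ^ 2 * B) := by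
        refine mul_le_mul_of_nonneg_right (Nat.cast_le.2 (Nat.sub_le _ _)) (by positivity)
    _ = _ := by push_cast; ring

namespace SpacedConfig

variable {S J N : ℕ} {s K M : ℝ} {P T : Finset (ℤ × ℤ)} {Tp : ℤ × ℤ → Finset (ℤ × ℤ)}

theorem S_pos (h : SpacedConfig S J N s K M P T Tp) : 0 < S := by have := h.two_le; omega

theorem S_real_pos (h : SpacedConfig S J N s K M P T Tp) : (0 : ℝ) < S := by exact_mod_cast h.S_pos

theorem one_le_S (h : SpacedConfig S J N s K M P T Tp) : (1 : ℝ) ≤ S := by exact_mod_cast h.S_pos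

theorem N_real_pos (h : SpacedConfig S J N s K M P T Tp) : (0 : ℝ) < N := by
  exact_mod_cast h.N_pos

theorem one_le_pow (h : SpacedConfig S J N s K M P T Tp) (i : ℕ) : (1 : ℝ) ≤ (S : ℝ) ^ i :=
  one_le_pow₀ h.one_le_S

theorem card_pos (h : SpacedConfig S J N s K M P T Tp) : (0 : ℝ) < P.card := by
  exact_mod_cast Finset.card_pos.2 h.nonempty

theorem pow_le_S_mul_N (h : SpacedConfig S J N s K M P T Tp) {i : ℕ} (hi : i ≤ J) :
    (S : ℝ) ^ i ≤ S * N :=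
  (pow_le_pow_right₀ h.one_le_S hi).trans (by exact_mod_cast h.le_N)

theorem near_top (h : SpacedConfig S J N s K M P T Tp) {p q : ℤ × ℤ} (hp : p ∈ P) (hq : q ∈ P) :
    Near S J p q := by
  have hN : (N : ℤ) ≤ (S : ℤ) ^ J := by exact_mod_cast h.N_le
  obtain ⟨h1, h2, h3, h4⟩ := h.box p hp
  obtain ⟨h5, h6, h7, h8⟩ := h.box q hq
  exact near_of_mem_box ⟨h1, h2.trans_le hN, h3, h4.trans_le hN⟩
    ⟨h5, h6.trans_le hN, h7, h8.trans_le hN⟩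

theorem smallScale_zero (h : SpacedConfig S J N s K M P T Tp) : SmallScale S N s P 0 := by
  simpa [SmallScale] using h.card_le

theorem smallScale_mono (h : SpacedConfig S J N s K M P T Tp) {i j : ℕ} (hij : i ≤ j)
    (hj : SmallScale S N s P j) : SmallScale S N s P i := by
  refine le_trans ?_ hj
  gcongr
  · linarith [h.s_le]
  · exact h.one_le_S

theorem card_cell_small (h : SpacedConfig S J N s K M P T Tp) {i : ℕ} (hi : i ≤ J)
    (hsm : SmallScale S N s P i) {p : ℤ × ℤ} (hp : p ∈ P) :
    ((P.filter fun q => cell S i q = cell S i p).card : ℝ) ≤ 2 * K * ((S : ℝ) ^ i) ^ s := by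
  have hW : (0 : ℝ) < (S : ℝ) ^ i := lt_of_lt_of_le one_pos (h.one_le_pow i)
  have hN := h.N_real_pos
  have hK := h.one_le_K
  have h0 : 0 < ((S : ℝ) ^ i) ^ s := by positivity
  refine (h.spacing p hp i hi).trans ?_
  have : max (((S : ℝ) ^ i / N) ^ (2 - s) * P.card) (((S : ℝ) ^ i) ^ s)
      ≤ 2 * ((S : ℝ) ^ i) ^ s := by
    refine max_le ?_ (by linarith)
    rw [Real.div_rpow hW.le hN.le, div_mul_eq_mul_div, div_le_iff₀ (by positivity)]
    have e : ((S : ℝ) ^ i) ^ (2 - s) = ((S : ℝ) ^ i) ^ s * ((S : ℝ) ^ i) ^ (2 - 2 * s) := by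
      rw [← Real.rpow_add hW]; congr 1; ring
    rw [e]
    have := mul_le_mul_of_nonneg_left hsm h0.le
    linarith
  nlinarith

theorem card_cell_large (h : SpacedConfig S J N s K M P T Tp) {i : ℕ} (hi : i ≤ J)
    (hsm : ¬ SmallScale S N s P i) {p : ℤ × ℤ} (hp : p ∈ P) :
    ((P.filter fun q => cell S i q = cell S i p).card : ℝ)
      ≤ K * (((S : ℝ) ^ i / N) ^ (2 - s) * P.card) := by
  have hW : (0 : ℝ) < (S : ℝ) ^ i := lt_of_lt_of_le one_pos (h.one_le_pow i)
  have hN := h.N_real_pos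
  have h0 : 0 < ((S : ℝ) ^ i) ^ s := by positivity
  refine (h.spacing p hp i hi).trans (le_of_eq ?_)
  rw [max_eq_left]
  rw [Real.div_rpow hW.le hN.le, div_mul_eq_mul_div, le_div_iff₀ (by positivity)]
  have e : ((S : ℝ) ^ i) ^ (2 - s) = ((S : ℝ) ^ i) ^ s * ((S : ℝ) ^ i) ^ (2 - 2 * s) := by
    rw [← Real.rpow_add hW]; congr 1; ring
  rw [e]
  have hlt : 2 * (N : ℝ) ^ (2 - s) < ((S : ℝ) ^ i) ^ (2 - 2 * s) * P.card := not_le.1 hsm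
  have hNp : 0 < (N : ℝ) ^ (2 - s) := by positivity
  have := mul_le_mul_of_nonneg_left (a := ((S : ℝ) ^ i) ^ s)
    (show (N : ℝ) ^ (2 - s) ≤ ((S : ℝ) ^ i) ^ (2 - 2 * s) * P.card by linarith) h0.le
  linarith

theorem card_filter_cell_le_of_subset {X Y : Finset (ℤ × ℤ)} (hXY : X ⊆ Y) (S i : ℕ) (p : ℤ × ℤ) :
    ((X.filter fun q => cell S i q = cell S i p).card : ℝ)
      ≤ ((Y.filter fun q => cell S i q = cell S i p).card : ℝ) := by
  exact_mod_cast Finset.card_le_card (Finset.filter_subset_filter _ hXY)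

theorem card_near_small (h : SpacedConfig S J N s K M P T Tp) {X : Finset (ℤ × ℤ)} (hX : X ⊆ P)
    {i : ℕ} (hi : i ≤ J) (hsm : SmallScale S N s P i) (p : ℤ × ℤ) :
    ((X.filter (Near S i p)).card : ℝ) ≤ 9 * (2 * K * ((S : ℝ) ^ i) ^ s) := by
  have hK := h.one_le_K
  refine card_near_le X (by positivity) (fun q hq => ?_) p
  exact (card_filter_cell_le_of_subset hX S i q).trans (h.card_cell_small hi hsm (hX hq))

theorem card_near_large (h : SpacedConfig S J N s K M P T Tp) {X : Finset (ℤ × ℤ)} (hX : X ⊆ P)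
    {i : ℕ} (hi : i ≤ J) (hsm : ¬ SmallScale S N s P i) (p : ℤ × ℤ) :
    ((X.filter (Near S i p)).card : ℝ) ≤ 9 * (K * (((S : ℝ) ^ i / N) ^ (2 - s) * P.card)) := by
  have hK := h.one_le_K
  refine card_near_le X (by positivity) (fun q hq => ?_) p
  exact (card_filter_cell_le_of_subset hX S i q).trans (h.card_cell_large hi hsm (hX hq))

/-- The energy of `P` at a scale where the first term of the spacing condition dominates. -/
theorem energy_large (h : SpacedConfig S J N s K M P T Tp) {X : Finset (ℤ × ℤ)} (hX : X ⊆ P)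
    {j : ℕ} (hj : j ≤ J) (hsm : ¬ SmallScale S N s P j) {p : ℤ × ℤ} (hp : p ∈ P) :
    ∑ q ∈ X, (S : ℝ) ^ j / max (supDist p q) ((S : ℝ) ^ j) ^ 2
      ≤ 9 * (J + 1) * (S : ℝ) ^ 2 * K * P.card * (N : ℝ) ^ (s - 2) * ((S : ℝ) ^ j) ^ (1 - s) := by
  have hS := h.S_real_pos
  have hN := h.N_real_pos
  have hK := h.one_le_K
  have hW : ∀ l, (0 : ℝ) < (S : ℝ) ^ l := fun l => by positivity
  refine (energy_le h.S_pos hj X p (fun q hq => h.near_top hp (hX hq))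
    (B := 9 * K * P.card * (N : ℝ) ^ (s - 2) * ((S : ℝ) ^ j) ^ (1 - s)) ?_).trans
    (le_of_eq (by ring))
  intro l hjl hl
  have h1 := h.card_near_large hX hl (fun hc => hsm (h.smallScale_mono hjl hc)) p
  refine (mul_le_mul_of_nonneg_left h1 (by positivity)).trans ?_
  have e1 : ((S : ℝ) ^ l / N) ^ (2 - s)
      = ((S : ℝ) ^ l) ^ 2 * ((S : ℝ) ^ l) ^ (-s) * (N : ℝ) ^ (s - 2) := by
    rw [Real.div_rpow (hW l).le hN.le, sub_eq_add_neg, Real.rpow_add (hW l),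
      show s - 2 = -(2 + -s) by ring, Real.rpow_neg hN.le (2 + -s), div_eq_mul_inv]
    norm_num
  have e2 : ((S : ℝ) ^ j) ^ (1 - s) = (S : ℝ) ^ j * ((S : ℝ) ^ j) ^ (-s) := by
    rw [sub_eq_add_neg, Real.rpow_add (hW j), Real.rpow_one]
  have h2 : ((S : ℝ) ^ l) ^ (-s) ≤ ((S : ℝ) ^ j) ^ (-s) :=
    Real.rpow_le_rpow_of_nonpos (hW j) (pow_le_pow_right₀ h.one_le_S hjl) (by linarith [h.s_pos])
  rw [e1, e2]
  have hne := (hW l).ne'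
  calc _ = 9 * K * P.card * (N : ℝ) ^ (s - 2) * ((S : ℝ) ^ j * ((S : ℝ) ^ l) ^ (-s)) := by
        field_simp
    _ ≤ _ := by gcongr

/-- The energy of a set whose cells at scale `S ^ j` have at most `B` points. -/
theorem energy_of_card_cell_le (h : SpacedConfig S J N s K M P T Tp) {X : Finset (ℤ × ℤ)}
    (hX : X ⊆ P) {j : ℕ} (hj : j ≤ J) {B : ℝ} (hB : 0 ≤ B)
    (hcell : ∀ q ∈ X, ((X.filter fun q' => cell S j q' = cell S j q).card : ℝ) ≤ B)
    {p : ℤ × ℤ} (hp : p ∈ P) :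
    ∑ q ∈ X, (S : ℝ) ^ j / max (supDist p q) ((S : ℝ) ^ j) ^ 2
      ≤ 9 * (J + 1) * (S : ℝ) ^ 2 * (B / (S : ℝ) ^ j) := by
  have hS := h.S_real_pos
  refine (energy_le h.S_pos hj X p (fun q hq => h.near_top hp (hX hq))
    (B := 9 * (B / (S : ℝ) ^ j)) ?_).trans (le_of_eq (by ring))
  intro l hjl hl
  have h1 := card_near_le X (S := S) (i := l) (by positivity)
    (fun q _ => card_cell_le_of_card_cell_le h.S_pos hjl X hB hcell q) p
  refine (mul_le_mul_of_nonneg_left h1 (by positivity)).trans (le_of_eq ?_)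
  field_simp

/-- Two-point bound: few tubes through `p` pass near a point `q` far away from `p`. -/
theorem card_tubes_through_le (h : SpacedConfig S J N s K M P T Tp) {p q : ℤ × ℤ} (hp : p ∈ P)
    (hq : q ∈ P) {W : ℝ} (hW : 0 < W) (hWd : W ≤ S * max (supDist p q) 1) :
    (((Tp p).filter fun t => |resid N t q| ≤ 4).card : ℝ) ≤ 16 * S * K * W ^ (-s) * M := by
  have hS := h.one_le_S
  have hN := h.N_real_pos
  have hK := h.one_le_K
  have hM := h.M_pos
  have key : ∀ ρ : ℝ, 1 ≤ ρ → ρ * W ≤ 16 * S * N →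
      K * (ρ / N) ^ s * M ≤ 16 * S * K * W ^ (-s) * M := by
    intro ρ hρ hρW
    have h1 : ρ / N ≤ (16 * S) * W⁻¹ := by
      rw [div_le_iff₀ hN, mul_right_comm, ← div_eq_mul_inv, le_div_iff₀ hW]
      exact hρW
    have h2 : (ρ / N) ^ s ≤ (16 * S) * W ^ (-s) := by
      calc (ρ / N) ^ s ≤ ((16 * S) * W⁻¹) ^ s := by gcongr; exact h.s_pos.le
        _ = (16 * (S : ℝ)) ^ s * W ^ (-s) := by
            rw [Real.mul_rpow (by positivity) (by positivity), Real.inv_rpow hW.le,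
              Real.rpow_neg hW.le]
        _ ≤ (16 * (S : ℝ)) ^ (1 : ℝ) * W ^ (-s) := by
            gcongr
            · linarith
            · exact h.s_le
        _ = _ := by rw [Real.rpow_one]
    calc _ ≤ K * ((16 * S) * W ^ (-s)) * M := by gcongr
      _ = _ := by ring
  have hd0 := supDist_nonneg p q
  rcases le_or_gt (supDist p q) 16 with hd | hd
  · refine le_trans ?_ (key N (by exact_mod_cast h.N_pos) ?_)
    · refine le_trans ?_ (h.direction p hp 0 N (by exact_mod_cast h.N_pos))
      refine Nat.cast_le.2 (Finset.card_le_card fun t ht => ?_)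
      rw [Finset.mem_filter] at ht ⊢
      exact ⟨ht.1, by simpa using h.slope p hp t ht.1⟩
    · have : max (supDist p q) 1 ≤ 16 := max_le hd (by norm_num)
      have hW16 : W ≤ S * 16 := hWd.trans (by gcongr)
      nlinarith
  · have hdN : supDist p q ≤ N := by
      obtain ⟨h1, h2, h3, h4⟩ := h.box p hp
      obtain ⟨h5, h6, h7, h8⟩ := h.box q hq
      refine max_le ?_ ?_
      · have : |p.1 - q.1| ≤ N := abs_le.2 ⟨by linarith, by linarith⟩
        exact_mod_cast this
      · have : |p.2 - q.2| ≤ N := abs_le.2 ⟨by linarith, by linarith⟩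
        exact_mod_cast this
    rw [max_eq_left (by linarith)] at hWd
    set d := supDist p q with hdd
    set x : ℝ := (p.1 : ℝ) - q.1 with hx
    set y : ℝ := (p.2 : ℝ) - q.2 with hy
    have hρ : 1 ≤ 16 * N / d := by rw [le_div_iff₀ (by linarith)]; linarith
    refine le_trans ?_ (key (16 * N / d) hρ ?_)
    · refine le_trans ?_ (h.direction p hp (N * y / x) (16 * N / d) hρ)
      refine Nat.cast_le.2 (Finset.card_le_card fun t ht => ?_)
      rw [Finset.mem_filter] at ht ⊢
      refine ⟨ht.1, ?_⟩
      have h1 := h.incident p hp t ht.1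
      have h2 := ht.2
      have h3 := h.slope p hp t ht.1
      set a : ℝ := (t.1 : ℝ) / N with ha
      have ha1 : |a| ≤ 1 := by
        rw [ha, abs_div, abs_of_pos hN, div_le_one hN]
        exact h3
      have h4 : |y - a * x| ≤ 8 := by
        have e : y - a * x = resid N t p - resid N t q := by
          simp only [resid, hx, hy, ha]; ring
        rw [e]
        exact (abs_sub _ _).trans (by linarith)
      have h5 : |a * x| ≤ |x| := by
        rw [abs_mul]
        nlinarith [abs_nonneg x]
      have h6 : |y| ≤ |x| + 8 := by
        have := abs_sub_abs_le_abs_sub y (a * x)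
        linarith
      have h7 : d / 2 ≤ |x| := by
        have : d ≤ |x| + 8 := max_le (by linarith) h6
        linarith
      have hx0 : 0 < |x| := by linarith
      have hxne : x ≠ 0 := abs_pos.1 hx0
      have e : (t.1 : ℝ) - N * y / x = -(N * (y - a * x) / x) := by
        rw [ha]; field_simp; ring
      rw [e, abs_neg, abs_div, abs_mul, abs_of_pos hN, div_le_div_iff₀ hx0 (by linarith)]
      have : |y - a * x| * d ≤ 8 * (2 * |x|) :=
        mul_le_mul h4 (by linarith) (by linarith) (by norm_num)
      nlinarith
    · rw [div_mul_eq_mul_div, div_le_iff₀ (by linarith)]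
      nlinarith

end SpacedConfig

/-- Discarding the incidences on poor tubes keeps at least half of them. -/
theorem exists_rich_subset {α β : Type*} [DecidableEq β] (I : Finset (α × β)) (T : Finset β)
    (hT : ∀ x ∈ I, x.2 ∈ T) {k : ℝ} (hk0 : 0 ≤ k) (hk : 2 * (T.card * k) ≤ I.card) :
    (I.card : ℝ) ≤ 2 * ((I.filter fun x => k ≤ ((I.filter fun y => y.2 = x.2).card : ℝ)).card : ℝ) := by
  set G := I.filter fun x => k ≤ ((I.filter fun y => y.2 = x.2).card : ℝ) with hG
  set B := I.filter fun x => ¬ k ≤ ((I.filter fun y => y.2 = x.2).card : ℝ) with hB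
  have h1 : G.card + B.card = I.card := Finset.card_filter_add_card_filter_not _
  have h2 : (B.card : ℝ) ≤ T.card * k := by
    rw [Finset.card_eq_sum_card_fiberwise (f := Prod.snd) (t := T)
      (fun x hx => hT x (Finset.mem_filter.1 hx).1)]
    push_cast
    rw [← nsmul_eq_mul, ← Finset.sum_const]
    refine Finset.sum_le_sum fun t _ => ?_
    rcases Finset.eq_empty_or_nonempty (B.filter fun x => x.2 = t) with he | ⟨x, hx⟩
    · rw [he]; simpa using hk0
    · rw [Finset.mem_filter, hB, Finset.mem_filter, not_le] at hx
      refine le_trans ?_ hx.1.2.le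
      rw [hx.2]
      exact_mod_cast Finset.card_le_card
        (Finset.filter_subset_filter _ (Finset.filter_subset _ _))
  have h3 : (G.card : ℝ) + B.card = I.card := by exact_mod_cast h1
  linarith

namespace SpacedConfig

variable {S J N : ℕ} {s K M : ℝ} {P T : Finset (ℤ × ℤ)} {Tp : ℤ × ℤ → Finset (ℤ × ℤ)}

/-- The number of points near `p` at scale `S ^ i` that lie on the tube `t`. -/
def nearCount (S N : ℕ) (X : Finset (ℤ × ℤ)) (i : ℕ) (p t : ℤ × ℤ) : ℕ :=
  (X.filter fun q => Near S i p q ∧ |resid N t q| ≤ 4).card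

theorem sum_nearCount_le (h : SpacedConfig S J N s K M P T Tp) {X : Finset (ℤ × ℤ)} (hX : X ⊆ P)
    {i : ℕ} (hi : i ≤ J) (hsm : SmallScale S N s P i) {p : ℤ × ℤ} (hp : p ∈ P) :
    ∑ t ∈ Tp p, (nearCount S N X i p t : ℝ) ≤ 288 * (J + 1) * S * K ^ 2 * M := by
  have hS := h.S_real_pos
  have hK := h.one_le_K
  have hM := h.M_pos
  have e : ∑ t ∈ Tp p, (nearCount S N X i p t : ℝ)
      = ∑ q ∈ X.filter (Near S i p), (((Tp p).filter fun t => |resid N t q| ≤ 4).card : ℝ) := by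
    simp only [nearCount, ← Finset.filter_filter]
    simp only [Finset.card_filter (fun q => |resid N _ q| ≤ 4),
      Finset.card_filter (fun t => |resid N t _| ≤ 4)]
    push_cast
    rw [Finset.sum_comm]
  rw [e]
  refine (sum_le_sum_shells (Nat.zero_le i) _ p (fun q hq => (Finset.mem_filter.1 hq).2)
    (fun q => (((Tp p).filter fun t => |resid N t q| ≤ 4).card : ℝ))
    fun q => Nat.cast_nonneg _).trans ?_
  calc _ ≤ ∑ _l ∈ Finset.Icc 0 i, 288 * S * K ^ 2 * M := by
        refine Finset.sum_le_sum fun l hl => ?_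
        rw [Finset.mem_Icc] at hl
        have hW : (0 : ℝ) < (S : ℝ) ^ l := by positivity
        calc _ ≤ ∑ q ∈ (X.filter (Near S i p)).filter (Shell S 0 l p),
              16 * S * K * ((S : ℝ) ^ l) ^ (-s) * M := by
              refine Finset.sum_le_sum fun q hq => ?_
              rw [Finset.mem_filter, Finset.mem_filter] at hq
              refine h.card_tubes_through_le hp (hX hq.1.1) hW ?_
              simpa using hq.2.le_supDist h.S_pos
          _ = (((X.filter (Near S i p)).filter (Shell S 0 l p)).card : ℝ) *
              (16 * S * K * ((S : ℝ) ^ l) ^ (-s) * M) := by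
              rw [Finset.sum_const, nsmul_eq_mul]
          _ ≤ 9 * (2 * K * ((S : ℝ) ^ l) ^ s) * (16 * S * K * ((S : ℝ) ^ l) ^ (-s) * M) := by
              refine mul_le_mul_of_nonneg_right ?_ (by positivity)
              refine le_trans (Nat.cast_le.2 (Finset.card_le_card fun q hq => ?_))
                (h.card_near_small hX (hl.2.trans hi) (h.smallScale_mono hl.2 hsm) p)
              rw [Finset.mem_filter, Finset.mem_filter] at hq
              exact Finset.mem_filter.2 ⟨hq.1.1, hq.2.1⟩
          _ = 288 * S * K ^ 2 * M * (((S : ℝ) ^ l) ^ s * ((S : ℝ) ^ l) ^ (-s)) := by ring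
          _ = 288 * S * K ^ 2 * M := by
              rw [← Real.rpow_add hW, add_neg_cancel, Real.rpow_zero, mul_one]
    _ = ((i + 1 : ℕ) : ℝ) * (288 * S * K ^ 2 * M) := by
        rw [Finset.sum_const, nsmul_eq_mul, Nat.card_Icc, Nat.sub_zero]
    _ ≤ ((J + 1 : ℕ) : ℝ) * (288 * S * K ^ 2 * M) := by
        refine mul_le_mul_of_nonneg_right (Nat.cast_le.2 (by omega)) (by positivity)
    _ = _ := by push_cast; ring

theorem card_good_tubes (h : SpacedConfig S J N s K M P T Tp) {X : Finset (ℤ × ℤ)} (hX : X ⊆ P)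
    {i : ℕ} (hi : i ≤ J) (hsm : SmallScale S N s P i) {p : ℤ × ℤ} (hp : p ∈ P) :
    M / 4 ≤ (((Tp p).filter fun t =>
      (nearCount S N X i p t : ℝ) ≤ 1152 * (J + 1) * S * K ^ 2).card : ℝ) := by
  have hS := h.S_real_pos
  have hK := h.one_le_K
  set v : ℝ := 1152 * (J + 1) * S * K ^ 2 with hv
  have hv0 : 0 < v := by positivity
  set G := (Tp p).filter fun t => (nearCount S N X i p t : ℝ) ≤ v with hG
  set B := (Tp p).filter fun t => ¬ (nearCount S N X i p t : ℝ) ≤ v with hB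
  have h1 : (G.card : ℝ) + B.card = (Tp p).card := by
    exact_mod_cast Finset.card_filter_add_card_filter_not _
  have h2 : B.card * v ≤ v * (M / 4) := by
    calc B.card * v = ∑ _t ∈ B, v := by rw [Finset.sum_const, nsmul_eq_mul]
      _ ≤ ∑ t ∈ B, (nearCount S N X i p t : ℝ) :=
          Finset.sum_le_sum fun t ht => (not_le.1 (Finset.mem_filter.1 ht).2).le
      _ ≤ ∑ t ∈ Tp p, (nearCount S N X i p t : ℝ) :=
          Finset.sum_le_sum_of_subset_of_nonneg (Finset.filter_subset _ _)
            fun _ _ _ => Nat.cast_nonneg _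
      _ ≤ 288 * (J + 1) * S * K ^ 2 * M := h.sum_nearCount_le hX hi hsm hp
      _ = v * (M / 4) := by rw [hv]; ring
  have h3 : (B.card : ℝ) ≤ M / 4 := by
    rw [mul_comm] at h2
    exact le_of_mul_le_mul_left h2 hv0
  linarith [h.card_tubes p hp]

theorem card_T_pos (h : SpacedConfig S J N s K M P T Tp) : (0 : ℝ) < T.card := by
  obtain ⟨p, hp⟩ := h.nonempty
  have h1 := h.card_tubes p hp
  have h2 : ((Tp p).card : ℝ) ≤ T.card := by exact_mod_cast Finset.card_le_card (h.subset p hp)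
  linarith [h.M_pos]

/-- There are many incidences of `X` whose tubes carry few nearby points but many points
at some single level. -/
theorem exists_incidences (h : SpacedConfig S J N s K M P T Tp) {X : Finset (ℤ × ℤ)} (hX : X ⊆ P)
    {i : ℕ} (hi : i ≤ J) (hsm : SmallScale S N s P i) :
    ∃ I₀ I₁ : Finset ((ℤ × ℤ) × (ℤ × ℤ)), I₁ ⊆ I₀ ∧
      (∀ x ∈ I₀, x.1 ∈ X ∧ x.2 ∈ Tp x.1 ∧
        (nearCount S N X i x.1 x.2 : ℝ) ≤ 1152 * (J + 1) * S * K ^ 2) ∧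
      X.card * M ≤ 8 * I₁.card ∧
      ∀ x ∈ I₁, ∃ l ≤ J, M * X.card / (8 * T.card * (J + 1)) ≤
        ((X.filter fun q => (q, x.2) ∈ I₀ ∧ Shell S 0 l x.1 q).card : ℝ) := by
  have hM := h.M_pos
  have hT := h.card_T_pos
  set v : ℝ := 1152 * (J + 1) * S * K ^ 2 with hv
  set I₀ := (X ×ˢ T).filter fun x => x.2 ∈ Tp x.1 ∧ (nearCount S N X i x.1 x.2 : ℝ) ≤ v with hI₀
  have hmem : ∀ x ∈ I₀, x.1 ∈ X ∧ x.2 ∈ Tp x.1 ∧ (nearCount S N X i x.1 x.2 : ℝ) ≤ v := by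
    intro x hx
    rw [hI₀, Finset.mem_filter, Finset.mem_product] at hx
    exact ⟨hx.1.1, hx.2⟩
  have hI₀T : ∀ x ∈ I₀, x.2 ∈ T := by
    intro x hx
    rw [hI₀, Finset.mem_filter, Finset.mem_product] at hx
    exact hx.1.2
  have hcard : X.card * M ≤ 4 * I₀.card := by
    rw [Finset.card_eq_sum_card_fiberwise (f := Prod.fst) (t := X) (fun x hx => (hmem x hx).1)]
    push_cast
    rw [Finset.mul_sum, ← nsmul_eq_mul, ← Finset.sum_const]
    refine Finset.sum_le_sum fun p hp => ?_
    have h1 := h.card_good_tubes hX hi hsm (hX hp)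
    have h2 : ((Tp p).filter fun t => (nearCount S N X i p t : ℝ) ≤ v).card
        ≤ (I₀.filter fun x => x.1 = p).card := by
      refine Finset.card_le_card_of_injOn (fun t => (p, t)) ?_ (fun a _ b _ hab => by simpa using hab)
      intro t ht
      rw [Finset.mem_coe, Finset.mem_filter] at ht ⊢
      rw [hI₀, Finset.mem_filter, Finset.mem_product]
      exact ⟨⟨⟨hp, h.subset p (hX hp) ht.1⟩, ht⟩, rfl⟩
    have h3 : (((Tp p).filter fun t => (nearCount S N X i p t : ℝ) ≤ v).card : ℝ)
        ≤ (I₀.filter fun x => x.1 = p).card := by exact_mod_cast h2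
    linarith
  set k : ℝ := M * X.card / (8 * T.card) with hk
  have hk0 : 0 ≤ k := by positivity
  have hrich := exists_rich_subset I₀ T hI₀T hk0 (by
    have : 2 * (T.card * k) = X.card * M / 4 := by rw [hk]; field_simp; ring
    rw [this]
    linarith)
  refine ⟨I₀, _, Finset.filter_subset _ _, hmem, by linarith, ?_⟩
  intro x hx
  rw [Finset.mem_filter] at hx
  have hxX := (hmem x hx.1).1
  by_contra hcon
  push Not at hcon
  set Y := X.filter fun q => (q, x.2) ∈ I₀ with hY
  have h1 : k ≤ Y.card := by
    refine hx.2.trans (Nat.cast_le.2 ?_)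
    refine Finset.card_le_card_of_injOn Prod.fst ?_ ?_
    · intro y hy
      rw [Finset.mem_coe, Finset.mem_filter] at hy ⊢
      refine ⟨(hmem y hy.1).1, ?_⟩
      rw [← hy.2]
      exact hy.1
    · intro y hy z hz hyz
      rw [Finset.mem_coe, Finset.mem_filter] at hy hz
      exact Prod.ext hyz (hy.2.trans hz.2.symm)
  have h2 := sum_le_sum_shells (Nat.zero_le J) Y x.1
    (fun q hq => h.near_top (hX hxX) (hX (Finset.mem_filter.1 hq).1)) (fun _ => 1) (by simp)
  simp only [Finset.sum_const, nsmul_eq_mul, mul_one] at h2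
  have h3 : ∑ l ∈ Finset.Icc 0 J, ((Y.filter (Shell S 0 l x.1)).card : ℝ)
      < ∑ _l ∈ Finset.Icc 0 J, M * X.card / (8 * T.card * (J + 1)) := by
    refine Finset.sum_lt_sum_of_nonempty ⟨0, by simp⟩ fun l hl => ?_
    rw [Finset.mem_Icc] at hl
    have := hcon l hl.2
    rwa [← Finset.filter_filter] at this
  rw [Finset.sum_const, Nat.card_Icc, nsmul_eq_mul, Nat.sub_zero] at h3
  have h4 : ((J + 1 : ℕ) : ℝ) * (M * X.card / (8 * T.card * (J + 1))) = k := by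
    rw [hk]; push_cast; field_simp
  linarith

end SpacedConfig

/-- The points of `X` in the `3 × 3` block of cells of side `S ^ i` around the cell `Q`. -/
def cellBlock (S : ℕ) (X : Finset (ℤ × ℤ)) (i : ℕ) (Q : ℤ × ℤ) : Finset (ℤ × ℤ) :=
  X.filter fun q => |Q.1 - (cell S i q).1| ≤ 1 ∧ |Q.2 - (cell S i q).2| ≤ 1

/-- The number of points of `X` near `p` at scale `S ^ i` and within `c` of the tube `t`. -/
def tubeCount (S N : ℕ) (X : Finset (ℤ × ℤ)) (i : ℕ) (c : ℝ) (p t : ℤ × ℤ) : ℕ :=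
  (X.filter fun q => Near S i p q ∧ |resid N t q| ≤ c).card

/-- The line of slope `a` and intercept `b` is within `S ^ j` of the tube `t` on the block of
cells of side `S ^ i` around `Q`. -/
def LineClose (S N i j : ℕ) (Q t : ℤ × ℤ) (a b : ℝ) : Prop :=
  |a - (t.1 : ℝ) / N| ≤ (S : ℝ) ^ j / (4 * (S : ℝ) ^ i) ∧
    |b + (a - (t.1 : ℝ) / N) * ((S : ℝ) ^ i * Q.1) - t.2| ≤ (S : ℝ) ^ j / 2

theorem sum_card_cellBlock_le (S : ℕ) (X : Finset (ℤ × ℤ)) (i : ℕ) (Y : Finset (ℤ × ℤ)) :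
    ∑ Q ∈ Y, (cellBlock S X i Q).card ≤ 9 * X.card := by
  simp only [cellBlock, Finset.card_filter]
  rw [Finset.sum_comm, mul_comm, ← smul_eq_mul, ← Finset.sum_const]
  refine Finset.sum_le_sum fun q _ => ?_
  rw [← Finset.card_filter]
  set c := cell S i q
  have hcard : (Finset.Icc (c.1 - 1) (c.1 + 1) ×ˢ Finset.Icc (c.2 - 1) (c.2 + 1)).card = 9 := by
    rw [Finset.card_product, Int.card_Icc, Int.card_Icc]
    have : ∀ x : ℤ, (x + 1 + 1 - (x - 1)).toNat = 3 := fun x => by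
      rw [show x + 1 + 1 - (x - 1) = 3 by ring]; rfl
    rw [this, this]
  rw [← hcard]
  refine Finset.card_le_card fun Q hQ => ?_
  obtain ⟨h1, h2⟩ := (Finset.mem_filter.1 hQ).2
  rw [abs_le] at h1 h2
  rw [Finset.mem_product, Finset.mem_Icc, Finset.mem_Icc]
  refine ⟨⟨?_, ?_⟩, ?_, ?_⟩ <;> linarith [h1.1, h1.2, h2.1, h2.2]

theorem abs_sub_corner_le {S i : ℕ} (hS : 0 < S) {X : Finset (ℤ × ℤ)} {Q q : ℤ × ℤ}
    (hq : q ∈ cellBlock S X i Q) : |(q.1 : ℝ) - (S : ℝ) ^ i * Q.1| ≤ 2 * (S : ℝ) ^ i := by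
  have hm : (0 : ℤ) < (S : ℤ) ^ i := by positivity
  have h1 := (Finset.mem_filter.1 hq).2.1
  simp only [cell] at h1
  rw [abs_le] at h1
  have h2 := Int.mul_ediv_add_emod q.1 ((S : ℤ) ^ i)
  have h3 := Int.emod_nonneg q.1 hm.ne'
  have h4 := Int.emod_lt_of_pos q.1 hm
  have : |q.1 - (S : ℤ) ^ i * Q.1| ≤ 2 * (S : ℤ) ^ i := by
    rw [abs_le]
    constructor <;> nlinarith
  exact_mod_cast this

theorem LineClose.abs_sub_resid_le {S N i j : ℕ} (hS : 0 < S) {X : Finset (ℤ × ℤ)}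
    {Q t q : ℤ × ℤ} {a b : ℝ} (h : LineClose S N i j Q t a b) (hq : q ∈ cellBlock S X i Q) :
    |((q.2 : ℝ) - a * q.1 - b) - resid N t q| ≤ (S : ℝ) ^ j := by
  have hR : (0 : ℝ) < (S : ℝ) ^ i := by positivity
  have h1 := abs_sub_corner_le hS hq
  obtain ⟨h2, h3⟩ := h
  set u := a - (t.1 : ℝ) / N with hu
  set v := b + u * ((S : ℝ) ^ i * Q.1) - t.2 with hv
  have e : ((q.2 : ℝ) - a * q.1 - b) - resid N t q = -(u * ((q.1 : ℝ) - (S : ℝ) ^ i * Q.1)) - v := by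
    simp only [resid, hv, hu]; ring
  have h4 : |u * ((q.1 : ℝ) - (S : ℝ) ^ i * Q.1)| ≤ (S : ℝ) ^ j / 2 := by
    rw [abs_mul]
    calc _ ≤ (S : ℝ) ^ j / (4 * (S : ℝ) ^ i) * (2 * (S : ℝ) ^ i) := by gcongr
      _ = _ := by field_simp; ring
  rw [e]
  refine (abs_sub _ _).trans ?_
  rw [abs_neg]
  linarith

theorem tubeCount_le_lineCount {S N i j : ℕ} (hS : 0 < S) {X : Finset (ℤ × ℤ)} {p t : ℤ × ℤ}
    {a b : ℝ} (h : LineClose S N i j (cell S i p) t a b) :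
    tubeCount S N X i (6 * (S : ℝ) ^ j) p t
      ≤ lineCount (cellBlock S X i (cell S i p)) (7 * (S : ℝ) ^ j) a b := by
  refine Finset.card_le_card fun q hq => ?_
  rw [Finset.mem_filter] at hq
  have hb : q ∈ cellBlock S X i (cell S i p) := Finset.mem_filter.2 ⟨hq.1, hq.2.1⟩
  refine Finset.mem_filter.2 ⟨hb, ?_⟩
  have h1 := h.abs_sub_resid_le hS hb
  have h2 := abs_sub_abs_le_abs_sub ((q.2 : ℝ) - a * q.1 - b) (resid N t q)
  linarith [hq.2.2]

theorem lineCount_le_tubeCount {S N i j : ℕ} (hS : 2 ≤ S) {X : Finset (ℤ × ℤ)} {p t : ℤ × ℤ}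
    {a b : ℝ} (h : LineClose S N i j (cell S i p) t a b) :
    lineCount (cellBlock S X i (cell S i p)) (5 * (S : ℝ) ^ (j + 1)) a b
      ≤ tubeCount S N X i (6 * (S : ℝ) ^ (j + 1)) p t := by
  refine Finset.card_le_card fun q hq => ?_
  rw [Finset.mem_filter] at hq
  have hb := Finset.mem_filter.1 hq.1
  refine Finset.mem_filter.2 ⟨hb.1, hb.2, ?_⟩
  have h1 := h.abs_sub_resid_le (by omega) hq.1
  rw [abs_sub_comm] at h1
  have h2 := abs_sub_abs_le_abs_sub (resid N t q) ((q.2 : ℝ) - a * q.1 - b)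
  have h3 : (S : ℝ) ^ j ≤ (S : ℝ) ^ (j + 1) :=
    pow_le_pow_right₀ (by exact_mod_cast (by omega : 1 ≤ S)) (by omega)
  linarith [hq.2]

/-- The local energy bound for incidences whose tubes are much denser at scale `S ^ j` than at
scale `S ^ (j + 1)`. -/
theorem card_le_energy_of_dense {S N i j : ℕ} (hS : 2 ≤ S) (hN : 0 < N) (hji : j ≤ i)
    (X : Finset (ℤ × ℤ)) (Q : ℤ × ℤ) (E : Finset ((ℤ × ℤ) × (ℤ × ℤ)))
    (hslope : ∀ x ∈ E, |(x.2.1 : ℝ)| ≤ N) (hQ : ∀ x ∈ E, cell S i x.1 = Q)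
    (hdense : ∀ x ∈ E, 3 * (tubeCount S N X i (6 * (S : ℝ) ^ (j + 1)) x.1 x.2 : ℝ)
      ≤ S * (tubeCount S N X i (6 * (S : ℝ) ^ j) x.1 x.2 : ℝ)) {θ : ℝ}
    (hθ : ∀ a b : ℝ, θ * ((E.filter fun x => LineClose S N i j Q x.2 a b).card : ℝ)
      ≤ (lineCount (cellBlock S X i Q) (7 * (S : ℝ) ^ j) a b : ℝ) ^ 2) :
    θ * E.card ≤ 3161088 * (S : ℝ) ^ i * (S : ℝ) ^ 2 *
      ∑ p ∈ cellBlock S X i Q, ∑ q ∈ cellBlock S X i Q,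
        (S : ℝ) ^ j / max (supDist p q) ((S : ℝ) ^ j) ^ 2 := by
  have hS2 : (2 : ℝ) ≤ S := by exact_mod_cast hS
  have hN' : (0 : ℝ) < N := by exact_mod_cast hN
  have hW : (0 : ℝ) < (S : ℝ) ^ j := by positivity
  have hR : (0 : ℝ) < (S : ℝ) ^ i := by positivity
  have hWR : (S : ℝ) ^ j ≤ (S : ℝ) ^ i := pow_le_pow_right₀ (by linarith) hji
  set Y := cellBlock S X i Q with hY
  set W : ℝ := (S : ℝ) ^ j with hWdef
  set R : ℝ := (S : ℝ) ^ i with hRdef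
  have hW' : (S : ℝ) ^ (j + 1) = S * W := by rw [pow_succ']
  have hfil : ∀ a b : ℝ, (E.filter fun e => |a - (e.2.1 : ℝ) / N| ≤ W / (4 * R) ∧
      |b + (a - (e.2.1 : ℝ) / N) * (R * Q.1) - (e.2.2 : ℝ)| ≤ W / 2)
      = E.filter fun x => LineClose S N i j Q x.2 a b := by
    intro a b
    ext x
    simp only [Finset.mem_filter]
    rfl
  have main := card_mul_area_le_energy Y E (fun x => (x.2.1 : ℝ) / N) (fun x => (x.2.2 : ℝ))
    (x0 := R * Q.1) (α := W / (4 * R)) (β := W / 2) (c := θ / (196 * W ^ 2))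
    (w := 7 * W) (w' := 5 * (S * W)) (by positivity) (by nlinarith) (by positivity)
    (by rw [div_le_one (by positivity)]; linarith) (by positivity)
    (fun x hx => by rw [abs_div, abs_of_pos hN', div_le_one hN']; exact hslope x hx)
    (by
      intro a b _
      rw [sum_bumpDiff_eq, hfil]
      rcases Finset.eq_empty_or_nonempty (E.filter fun x => LineClose S N i j Q x.2 a b)
        with he | ⟨x, hx⟩
      · rw [he, Finset.card_empty]
        simpa using sq_nonneg _
      rw [Finset.mem_filter] at hx
      set F : ℝ := (lineCount Y (7 * W) a b : ℝ) with hF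
      set F' : ℝ := (lineCount Y (5 * (S * W)) a b : ℝ) with hF'
      have hF0 : 0 ≤ F := Nat.cast_nonneg _
      have hxQ := hQ x hx.1
      have hclose := hx.2
      rw [← hxQ] at hclose
      have h1 : (tubeCount S N X i (6 * W) x.1 x.2 : ℝ) ≤ F := by
        have := tubeCount_le_lineCount (X := X) (by omega) hclose
        rw [hxQ] at this
        exact Nat.cast_le.2 this
      have h2 : F' ≤ tubeCount S N X i (6 * (S * W)) x.1 x.2 := by
        have := lineCount_le_tubeCount (X := X) hS hclose
        rw [hxQ, hW'] at this
        exact Nat.cast_le.2 this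
      have h3 := hdense x hx.1
      rw [hW'] at h3
      have h4 : F / (14 * W) ≤ F / (7 * W) - F' / (5 * (S * W)) := by
        have h5 : 3 * F' ≤ S * F := by nlinarith
        have h6 : F' / (5 * (S * W)) ≤ F / (15 * W) := by
          rw [div_le_div_iff₀ (by positivity) (by positivity)]
          nlinarith
        have h7 : F / (7 * W) - F / (15 * W) - F / (14 * W) = F / W * (1 / 210) := by
          field_simp; ring
        have h8 : 0 ≤ F / W * (1 / 210) := by positivity
        linarith
      calc _ = θ * ((E.filter fun x => LineClose S N i j Q x.2 a b).card : ℝ)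
            / (196 * W ^ 2) := by
            rw [div_mul_eq_mul_div]
        _ ≤ F ^ 2 / (196 * W ^ 2) := by
            have := hθ a b
            gcongr
        _ = (F / (14 * W)) ^ 2 := by rw [div_pow]; ring
        _ ≤ _ := by gcongr)
  have hsum : ∑ p ∈ Y, ∑ q ∈ Y,
      7 * W / max (max |(p.1 : ℝ) - q.1| |(p.2 : ℝ) - q.2|) (7 * W) ^ 2
      ≤ 7 * ∑ p ∈ Y, ∑ q ∈ Y, W / max (supDist p q) W ^ 2 := by
    simp only [Finset.mul_sum]
    refine Finset.sum_le_sum fun p _ => Finset.sum_le_sum fun q _ => ?_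
    rw [← mul_div_assoc]
    have h1 : 0 < max (supDist p q) W := lt_max_of_lt_right hW
    have h2 : max (supDist p q) W ≤ max (max |(p.1 : ℝ) - q.1| |(p.2 : ℝ) - q.2|) (7 * W) :=
      max_le_max le_rfl (by linarith)
    gcongr
  set G := ∑ p ∈ Y, ∑ q ∈ Y, W / max (supDist p q) W ^ 2 with hG
  have hG0 : 0 ≤ G := Finset.sum_nonneg fun p _ => Finset.sum_nonneg fun q _ => by positivity
  have h1 : θ / (196 * W ^ 2) * E.card * (4 * (W / (4 * R)) * (W / 2)) = θ * E.card / (392 * R) := by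
    field_simp
    ring
  rw [h1, div_le_iff₀ (by positivity)] at main
  refine main.trans ?_
  have h2 : (5 * (S * W) / (7 * W)) ^ 2 ≤ (S : ℝ) ^ 2 := by
    have : 5 * (S * W) / (7 * W) = (5 / 7) * S := by field_simp
    rw [this]
    gcongr
    linarith
  calc _ ≤ 1152 * (S : ℝ) ^ 2 * (7 * G) * (392 * R) := by
        gcongr
    _ = _ := by ring

/-- Summing the local energy bounds over all cells of side `S ^ i`. -/
theorem card_incidences_le_energy {S N i j : ℕ} (hS : 2 ≤ S) (hN : 0 < N) (hji : j ≤ i)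
    (X : Finset (ℤ × ℤ)) (I : Finset ((ℤ × ℤ) × (ℤ × ℤ)))
    (hslope : ∀ x ∈ I, |(x.2.1 : ℝ)| ≤ N)
    (hdense : ∀ x ∈ I, 3 * (tubeCount S N X i (6 * (S : ℝ) ^ (j + 1)) x.1 x.2 : ℝ)
      ≤ S * (tubeCount S N X i (6 * (S : ℝ) ^ j) x.1 x.2 : ℝ)) {θ : ℝ}
    (hθ : ∀ (Q : ℤ × ℤ) (a b : ℝ),
      θ * ((I.filter fun x => cell S i x.1 = Q ∧ LineClose S N i j Q x.2 a b).card : ℝ)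
      ≤ (lineCount (cellBlock S X i Q) (7 * (S : ℝ) ^ j) a b : ℝ) ^ 2) {B : ℝ} (hB0 : 0 ≤ B)
    (hB : ∀ p ∈ X, ∑ q ∈ X, (S : ℝ) ^ j / max (supDist p q) ((S : ℝ) ^ j) ^ 2 ≤ B) :
    θ * I.card ≤ 28449792 * (S : ℝ) ^ i * (S : ℝ) ^ 2 * X.card * B := by
  have hS0 : (0 : ℝ) < S := by exact_mod_cast (by omega : 0 < S)
  set C := I.image fun x => cell S i x.1 with hC
  rw [Finset.card_eq_sum_card_fiberwise (f := fun x => cell S i x.1) (t := C)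
    (fun x hx => Finset.mem_image_of_mem _ hx)]
  push_cast
  rw [Finset.mul_sum]
  calc _ ≤ ∑ Q ∈ C, 3161088 * (S : ℝ) ^ i * (S : ℝ) ^ 2 * ((cellBlock S X i Q).card * B) := by
        refine Finset.sum_le_sum fun Q _ => ?_
        refine (card_le_energy_of_dense hS hN hji X Q (I.filter fun x => cell S i x.1 = Q)
          (fun x hx => hslope x (Finset.mem_filter.1 hx).1)
          (fun x hx => (Finset.mem_filter.1 hx).2)
          (fun x hx => hdense x (Finset.mem_filter.1 hx).1) (θ := θ) ?_).trans ?_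
        · intro a b
          rw [Finset.filter_filter]
          exact hθ Q a b
        · refine mul_le_mul_of_nonneg_left ?_ (by positivity)
          rw [← nsmul_eq_mul, ← Finset.sum_const]
          refine Finset.sum_le_sum fun p hp => ?_
          refine le_trans ?_ (hB p (Finset.mem_filter.1 hp).1)
          exact Finset.sum_le_sum_of_subset_of_nonneg (Finset.filter_subset _ _)
            fun _ _ _ => by positivity
    _ = 3161088 * (S : ℝ) ^ i * (S : ℝ) ^ 2 * (((∑ Q ∈ C, (cellBlock S X i Q).card : ℕ) : ℝ) * B) := by
        rw [← Finset.mul_sum, ← Finset.sum_mul]; push_cast; rfl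
    _ ≤ 3161088 * (S : ℝ) ^ i * (S : ℝ) ^ 2 * (((9 * X.card : ℕ) : ℝ) * B) := by
        gcongr
        exact sum_card_cellBlock_le S X i C
    _ = _ := by push_cast; ring

theorem sum_incidences_le {α β : Type*} (E : Finset (α × β)) (Y : Finset α)
    (F : α → Finset β) (hE : ∀ x ∈ E, x.1 ∈ Y ∧ x.2 ∈ F x.1) (g : α → β → ℝ)
    (hg : ∀ p t, 0 ≤ g p t) : ∑ x ∈ E, g x.1 x.2 ≤ ∑ p ∈ Y, ∑ t ∈ F p, g p t := by
  rw [Finset.sum_sigma']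
  have e : ∑ x ∈ E, g x.1 x.2
      = ∑ y ∈ E.image (fun x => (⟨x.1, x.2⟩ : (_ : α) × β)), g y.1 y.2 := by
    rw [Finset.sum_image]
    rintro ⟨a, b⟩ _ ⟨c, d⟩ _ hxy
    simpa using hxy
  rw [e]
  refine Finset.sum_le_sum_of_subset_of_nonneg ?_ fun _ _ _ => hg _ _
  intro y hy
  obtain ⟨x, hx, rfl⟩ := Finset.mem_image.1 hy
  exact Finset.mem_sigma.2 (hE x hx)

theorem exists_descent {a : ℕ → ℝ} {c : ℝ} {i J : ℕ} (hiJ : i ≤ J)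
    (hc : 0 < c) (h0 : 3 ^ J * c ≤ a 0) (hi : a i < c) :
    ∃ j < i, c ≤ a j ∧ 3 * a (j + 1) ≤ a j ∧ a (j + 1) ≤ 3 ^ J * c := by
  have hex : ∃ m, a m < 3 ^ (J - m) * c := ⟨i, hi.trans_le (by
    have : (1 : ℝ) ≤ 3 ^ (J - i) := one_le_pow₀ (by norm_num)
    nlinarith)⟩
  have hle : Nat.find hex ≤ i := Nat.find_min' hex (hi.trans_le (by
    have : (1 : ℝ) ≤ 3 ^ (J - i) := one_le_pow₀ (by norm_num)
    nlinarith))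
  have hspec := Nat.find_spec hex
  have hpos : Nat.find hex ≠ 0 := by
    intro hz
    rw [hz, Nat.sub_zero] at hspec
    linarith
  obtain ⟨j, hj⟩ := Nat.exists_eq_succ_of_ne_zero hpos
  have hnot := Nat.find_min hex (m := j) (by omega)
  rw [hj, Nat.succ_eq_add_one] at hspec
  rw [not_lt] at hnot
  have hpow : (3 : ℝ) ^ (J - j) = 3 * 3 ^ (J - (j + 1)) := by
    rw [← pow_succ']
    congr 1
    omega
  refine ⟨j, by omega, le_trans ?_ hnot, ?_, hspec.le.trans ?_⟩
  · have : (1 : ℝ) ≤ 3 ^ (J - j) := one_le_pow₀ (by norm_num)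
    nlinarith
  · rw [hpow] at hnot
    linarith
  · gcongr
    · norm_num
    · omega

theorem abs_resid_sub_le {S N j : ℕ} (hS : 0 < S) (hN : 0 < N) {t q q₀ : ℤ × ℤ}
    (ht : |(t.1 : ℝ)| ≤ N) (h : cell S j q = cell S j q₀) :
    |resid N t q - resid N t q₀| ≤ 2 * (S : ℝ) ^ j := by
  have hm : (0 : ℤ) < (S : ℤ) ^ j := by positivity
  have hN' : (0 : ℝ) < N := by exact_mod_cast hN
  have key : ∀ u v : ℤ, u / (S : ℤ) ^ j = v / (S : ℤ) ^ j → |(u : ℝ) - v| ≤ (S : ℝ) ^ j := by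
    intro u v huv
    have h1 := Int.mul_ediv_add_emod u ((S : ℤ) ^ j)
    have h2 := Int.mul_ediv_add_emod v ((S : ℤ) ^ j)
    have h3 := Int.emod_nonneg u hm.ne'
    have h4 := Int.emod_nonneg v hm.ne'
    have h5 := Int.emod_lt_of_pos u hm
    have h6 := Int.emod_lt_of_pos v hm
    rw [huv] at h1
    have : |u - v| ≤ (S : ℤ) ^ j := by
      rw [abs_le]
      constructor <;> linarith
    exact_mod_cast this
  have h1 := key _ _ (congrArg Prod.fst h)
  have h2 := key _ _ (congrArg Prod.snd h)
  have ha : |(t.1 : ℝ) / N| ≤ 1 := by rwa [abs_div, abs_of_pos hN', div_le_one hN']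
  have e : resid N t q - resid N t q₀
      = ((q.2 : ℝ) - q₀.2) - (t.1 : ℝ) / N * ((q.1 : ℝ) - q₀.1) := by
    simp only [resid]; ring
  rw [e]
  refine (abs_sub _ _).trans ?_
  rw [abs_mul]
  have h3 : |(t.1 : ℝ) / N| * |(q.1 : ℝ) - q₀.1| ≤ 1 * (S : ℝ) ^ j :=
    mul_le_mul ha h1 (abs_nonneg _) zero_le_one
  linarith

theorem tubeCount_mono {S N : ℕ} (X : Finset (ℤ × ℤ)) (i : ℕ) {c c' : ℝ} (hc : c ≤ c')
    (p t : ℤ × ℤ) : tubeCount S N X i c p t ≤ tubeCount S N X i c' p t := by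
  refine Finset.card_le_card fun q hq => ?_
  rw [Finset.mem_filter] at hq ⊢
  exact ⟨hq.1, hq.2.1, hq.2.2.trans hc⟩

namespace SpacedConfig

variable {S J N : ℕ} {s K M : ℝ} {P T : Finset (ℤ × ℤ)} {Tp : ℤ × ℤ → Finset (ℤ × ℤ)}

theorem mem_lineCount_set (h : SpacedConfig S J N s K M P T Tp) {X : Finset (ℤ × ℤ)}
    {i j : ℕ} {Q t q : ℤ × ℤ} {a b : ℝ} (hq : q ∈ cellBlock S X i Q) (hr : |resid N t q| ≤ 4)
    (hc : LineClose S N i j Q t a b) : |(q.2 : ℝ) - a * q.1 - b| ≤ 7 * (S : ℝ) ^ j := by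
  have h1 := hc.abs_sub_resid_le h.S_pos hq
  have h2 := abs_sub_abs_le_abs_sub ((q.2 : ℝ) - a * q.1 - b) (resid N t q)
  have h3 := h.one_le_pow j
  linarith

/-- A tube-density bound at scales where the first term of the spacing condition dominates. -/
theorem density_le_of_large (h : SpacedConfig S J N s K M P T Tp) {X : Finset (ℤ × ℤ)}
    (hX : X ⊆ P) (hXne : X.Nonempty) {i j : ℕ} (hi : i ≤ J) (hji : j < i)
    (hsm : ¬ SmallScale S N s P j) (I : Finset ((ℤ × ℤ) × (ℤ × ℤ)))
    (hI : ∀ x ∈ I, x.1 ∈ X ∧ x.2 ∈ Tp x.1)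
    (hdense : ∀ x ∈ I, 3 * (tubeCount S N X i (6 * (S : ℝ) ^ (j + 1)) x.1 x.2 : ℝ)
      ≤ S * (tubeCount S N X i (6 * (S : ℝ) ^ j) x.1 x.2 : ℝ)) {H L : ℝ} (hH0 : 0 ≤ H)
    (hL0 : 0 ≤ L) (hH : ∀ x ∈ I, H ≤ (tubeCount S N X i (6 * (S : ℝ) ^ j) x.1 x.2 : ℝ))
    (hL : X.card * M ≤ L * I.card) :
    H ≤ 256048128 * L * (J + 1) * K ^ 2 * (S : ℝ) ^ 5 *
      ((S : ℝ) ^ j * (((S : ℝ) ^ i) ^ (1 - s) * P.card * (N : ℝ) ^ (s - 2))) := by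
  have hS := h.one_le_S
  have hS0 := h.S_real_pos
  have hN := h.N_real_pos
  have hK := h.one_le_K
  have hM := h.M_pos
  have hW : (0 : ℝ) < (S : ℝ) ^ j := by positivity
  have hR : (0 : ℝ) < (S : ℝ) ^ i := by positivity
  have hW1 := h.one_le_pow j
  have hRN := h.pow_le_S_mul_N hi
  have hXc : (0 : ℝ) < X.card := by exact_mod_cast Finset.card_pos.2 hXne
  set m : ℝ := K * (S * ((S : ℝ) ^ j) ^ s * ((S : ℝ) ^ i) ^ (-s)) * M with hm
  have hm0 : 0 < m := by positivity
  have hmult : ∀ p ∈ P, ∀ a : ℝ, (((Tp p).filter fun t =>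
      |a - (t.1 : ℝ) / N| ≤ (S : ℝ) ^ j / (4 * (S : ℝ) ^ i)).card : ℝ) ≤ m := by
    intro p hp a
    set ρ : ℝ := S * N * (S : ℝ) ^ j / (S : ℝ) ^ i with hρ
    have hρ1 : 1 ≤ ρ := by
      rw [hρ, le_div_iff₀ hR]
      nlinarith
    refine le_trans (Nat.cast_le.2 (Finset.card_le_card fun t ht => ?_))
      ((h.direction p hp (a * N) ρ hρ1).trans ?_)
    · rw [Finset.mem_filter] at ht ⊢
      refine ⟨ht.1, ?_⟩
      have e : (t.1 : ℝ) - a * N = -((a - (t.1 : ℝ) / N) * N) := by field_simp; ring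
      rw [e, abs_neg, abs_mul, abs_of_pos hN]
      calc _ ≤ (S : ℝ) ^ j / (4 * (S : ℝ) ^ i) * N := by gcongr; exact ht.2
        _ = N * (S : ℝ) ^ j / (S : ℝ) ^ i / 4 := by field_simp
        _ ≤ ρ := by
            have : ρ = S * (N * (S : ℝ) ^ j / (S : ℝ) ^ i) := by rw [hρ]; ring
            have h0 : 0 ≤ N * (S : ℝ) ^ j / (S : ℝ) ^ i := by positivity
            rw [this]
            nlinarith
    · rw [hm]
      gcongr
      have e : ρ / N = S * ((S : ℝ) ^ j / (S : ℝ) ^ i) := by rw [hρ]; field_simp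
      rw [e, Real.mul_rpow hS0.le (by positivity), Real.div_rpow hW.le hR.le, Real.rpow_neg hR.le,
        ← div_eq_mul_inv, mul_div_assoc]
      gcongr
      calc (S : ℝ) ^ s ≤ (S : ℝ) ^ (1 : ℝ) := Real.rpow_le_rpow_of_exponent_le hS h.s_le
        _ = S := Real.rpow_one _
  set B : ℝ := 9 * (J + 1) * (S : ℝ) ^ 2 * K * P.card * (N : ℝ) ^ (s - 2) *
    ((S : ℝ) ^ j) ^ (1 - s) with hB
  have main := card_incidences_le_energy h.two_le h.N_pos hji.le X I
    (fun x hx => h.slope x.1 (hX (hI x hx).1) x.2 (hI x hx).2) hdense (θ := H / m) (B := B) ?_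
    (by positivity) (fun p hp => h.energy_large hX (hji.le.trans hi) hsm (hX hp))
  · have h1 : H * (X.card * M) ≤ m * (L * (28449792 * (S : ℝ) ^ i * (S : ℝ) ^ 2 * X.card * B)) := by
      calc H * (X.card * M) ≤ H * (L * I.card) := by gcongr
        _ = m * (L * (H / m * I.card)) := by field_simp
        _ ≤ _ := by gcongr
    have hRp : ((S : ℝ) ^ i) ^ (-s) * (S : ℝ) ^ i = ((S : ℝ) ^ i) ^ (1 - s) := by
      rw [sub_eq_add_neg, add_comm, Real.rpow_add hR, Real.rpow_one]
    have hWp : ((S : ℝ) ^ j) ^ s * ((S : ℝ) ^ j) ^ (1 - s) = (S : ℝ) ^ j := by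
      rw [← Real.rpow_add hW, add_sub_cancel, Real.rpow_one]
    have h2 : m * (L * (28449792 * (S : ℝ) ^ i * (S : ℝ) ^ 2 * X.card * B))
        = (256048128 * L * (J + 1) * K ^ 2 * (S : ℝ) ^ 5 *
      ((S : ℝ) ^ j * (((S : ℝ) ^ i) ^ (1 - s) * P.card * (N : ℝ) ^ (s - 2)))) * (X.card * M) := by
      rw [← hRp]
      rw [hm, hB]
      linear_combination (256048128 * L * (J + 1) * K ^ 2 * (S : ℝ) ^ 5 *
        (((S : ℝ) ^ i) ^ (-s) * (S : ℝ) ^ i * P.card * (N : ℝ) ^ (s - 2)) * (X.card * M)) * hWp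
    rw [h2] at h1
    exact le_of_mul_le_mul_right h1 (by positivity)
  · intro Q a b
    set E := I.filter fun x => cell S i x.1 = Q ∧ LineClose S N i j Q x.2 a b with hE
    rcases Finset.eq_empty_or_nonempty E with he | ⟨x, hx⟩
    · rw [he, Finset.card_empty]
      simp
    set F : ℝ := (lineCount (cellBlock S X i Q) (7 * (S : ℝ) ^ j) a b : ℝ) with hF
    have hF0 : 0 ≤ F := Nat.cast_nonneg _
    have h1 : H ≤ F := by
      rw [hE, Finset.mem_filter] at hx
      refine (hH x hx.1).trans (Nat.cast_le.2 ?_)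
      have hc := hx.2.2
      rw [← hx.2.1] at hc ⊢
      exact tubeCount_le_lineCount h.S_pos hc
    have h2 : (E.card : ℝ) ≤ F * m := by
      have := sum_incidences_le E
        ((cellBlock S X i Q).filter fun q => |(q.2 : ℝ) - a * q.1 - b| ≤ 7 * (S : ℝ) ^ j)
        (fun p => (Tp p).filter fun t => |a - (t.1 : ℝ) / N| ≤ (S : ℝ) ^ j / (4 * (S : ℝ) ^ i))
        (by
          intro x hx
          rw [hE, Finset.mem_filter] at hx
          obtain ⟨hxX, hxT⟩ := hI x hx.1
          have hb : x.1 ∈ cellBlock S X i Q :=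
            Finset.mem_filter.2 ⟨hxX, by rw [hx.2.1]; simp⟩
          exact ⟨Finset.mem_filter.2 ⟨hb, h.mem_lineCount_set hb
            (h.incident x.1 (hX hxX) x.2 hxT) hx.2.2⟩, Finset.mem_filter.2 ⟨hxT, hx.2.2.1⟩⟩)
        (fun _ _ => 1) (fun _ _ => zero_le_one)
      simp only [Finset.sum_const, nsmul_eq_mul, mul_one] at this
      refine this.trans ?_
      rw [hF, lineCount, ← nsmul_eq_mul, ← Finset.sum_const]
      refine Finset.sum_le_sum fun p hp => hmult p (hX ?_) a
      exact (Finset.mem_filter.1 (Finset.mem_filter.1 hp).1).1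
    calc H / m * E.card ≤ H / m * (F * m) := by gcongr
      _ = H * F := by field_simp
      _ ≤ F ^ 2 := by nlinarith

/-- A richness bound coming from pairs of points at distance about `S ^ i` on a common tube. -/
theorem richness_le_of_card_cell_le (h : SpacedConfig S J N s K M P T Tp) {X : Finset (ℤ × ℤ)}
    (hX : X ⊆ P) (hXne : X.Nonempty) {i j : ℕ} (hi : i ≤ J) (hji : j < i)
    (I : Finset ((ℤ × ℤ) × (ℤ × ℤ))) (hI : ∀ x ∈ I, x.1 ∈ X ∧ x.2 ∈ Tp x.1)
    (hdense : ∀ x ∈ I, 3 * (tubeCount S N X i (6 * (S : ℝ) ^ (j + 1)) x.1 x.2 : ℝ)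
      ≤ S * (tubeCount S N X i (6 * (S : ℝ) ^ j) x.1 x.2 : ℝ)) {k L B : ℝ} (hk0 : 0 ≤ k)
    (hL0 : 0 ≤ L) (hB0 : 0 ≤ B)
    (hcell : ∀ q ∈ X, ((X.filter fun q' => cell S j q' = cell S j q).card : ℝ) ≤ B)
    (hk : ∀ x ∈ I, k ≤ ((X.filter fun q => |resid N x.2 q| ≤ 4 ∧ Shell S 0 i x.1 q).card : ℝ))
    (hL : X.card * M ≤ L * I.card) :
    k * (S : ℝ) ^ j ≤ 4096770048 * L * (J + 1) * K * (S : ℝ) ^ 5 *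
      (((S : ℝ) ^ i) ^ (1 - s) * B) := by
  have hS := h.one_le_S
  have hS0 := h.S_real_pos
  have hK := h.one_le_K
  have hM := h.M_pos
  have hW : (0 : ℝ) < (S : ℝ) ^ j := by positivity
  have hR : (0 : ℝ) < (S : ℝ) ^ i := by positivity
  have hXc : (0 : ℝ) < X.card := by exact_mod_cast Finset.card_pos.2 hXne
  set m : ℝ := 16 * S * K * ((S : ℝ) ^ i) ^ (-s) * M with hm
  have hm0 : 0 < m := by positivity
  set B' : ℝ := 9 * (J + 1) * (S : ℝ) ^ 2 * (B / (S : ℝ) ^ j) with hB'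
  have main := card_incidences_le_energy h.two_le h.N_pos hji.le X I
    (fun x hx => h.slope x.1 (hX (hI x hx).1) x.2 (hI x hx).2) hdense (θ := k / m) (B := B') ?_
    (by positivity)
    (fun p hp => h.energy_of_card_cell_le hX (hji.le.trans hi) hB0 hcell (hX hp))
  · have h1 : k * (X.card * M) ≤ m * (L * (28449792 * (S : ℝ) ^ i * (S : ℝ) ^ 2 * X.card * B')) := by
      calc k * (X.card * M) ≤ k * (L * I.card) := by gcongr
        _ = m * (L * (k / m * I.card)) := by field_simp
        _ ≤ _ := by gcongr
    have hRp : ((S : ℝ) ^ i) ^ (-s) * (S : ℝ) ^ i = ((S : ℝ) ^ i) ^ (1 - s) := by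
      rw [sub_eq_add_neg, add_comm, Real.rpow_add hR, Real.rpow_one]
    have h2 : m * (L * (28449792 * (S : ℝ) ^ i * (S : ℝ) ^ 2 * X.card * B')) * (S : ℝ) ^ j
        = (4096770048 * L * (J + 1) * K * (S : ℝ) ^ 5 *
      (((S : ℝ) ^ i) ^ (1 - s) * B)) * (X.card * M) := by
      rw [← hRp, hm, hB']
      field_simp
      ring
    have h3 := mul_le_mul_of_nonneg_right h1 hW.le
    rw [h2] at h3
    refine le_of_mul_le_mul_right (a := X.card * M) ?_ (by positivity)
    linarith
  · intro Q a b
    set E := I.filter fun x => cell S i x.1 = Q ∧ LineClose S N i j Q x.2 a b with hE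
    set Y := (cellBlock S X i Q).filter fun q => |(q.2 : ℝ) - a * q.1 - b| ≤ 7 * (S : ℝ) ^ j with hY
    have hYP : ∀ p ∈ Y, p ∈ P := fun p hp =>
      hX (Finset.mem_filter.1 (Finset.mem_filter.1 hp).1).1
    have hF : (lineCount (cellBlock S X i Q) (7 * (S : ℝ) ^ j) a b : ℝ) = Y.card := rfl
    rw [hF]
    have h1 : k * E.card ≤ ∑ x ∈ E,
        ((Y.filter fun q => Shell S 0 i x.1 q ∧ |resid N x.2 q| ≤ 4).card : ℝ) := by
      rw [mul_comm, ← nsmul_eq_mul, ← Finset.sum_const]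
      refine Finset.sum_le_sum fun x hx => ?_
      rw [hE, Finset.mem_filter] at hx
      refine (hk x hx.1).trans (Nat.cast_le.2 (Finset.card_le_card fun q hq => ?_))
      rw [Finset.mem_filter] at hq ⊢
      have hb : q ∈ cellBlock S X i Q := by
        refine Finset.mem_filter.2 ⟨hq.1, ?_⟩
        rw [← hx.2.1]
        exact hq.2.2.1
      exact ⟨Finset.mem_filter.2 ⟨hb, h.mem_lineCount_set hb hq.2.1 hx.2.2⟩, hq.2.2, hq.2.1⟩
    have h2 := sum_incidences_le E Y Tp (by
        intro x hx
        rw [hE, Finset.mem_filter] at hx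
        obtain ⟨hxX, hxT⟩ := hI x hx.1
        have hb : x.1 ∈ cellBlock S X i Q :=
          Finset.mem_filter.2 ⟨hxX, by rw [hx.2.1]; simp⟩
        exact ⟨Finset.mem_filter.2 ⟨hb, h.mem_lineCount_set hb
          (h.incident x.1 (hX hxX) x.2 hxT) hx.2.2⟩, hxT⟩)
      (fun p t => ((Y.filter fun q => Shell S 0 i p q ∧ |resid N t q| ≤ 4).card : ℝ))
      (fun _ _ => Nat.cast_nonneg _)
    have h3 : ∑ p ∈ Y, ∑ t ∈ Tp p,
        ((Y.filter fun q => Shell S 0 i p q ∧ |resid N t q| ≤ 4).card : ℝ)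
        ≤ ∑ _p ∈ Y, ∑ _q ∈ Y, m := by
      refine Finset.sum_le_sum fun p hp => ?_
      simp only [← Finset.filter_filter, Finset.card_filter (fun q => |resid N _ q| ≤ 4)]
      push_cast
      rw [Finset.sum_comm]
      refine (Finset.sum_le_sum (g := fun _ => m) fun q hq => ?_).trans
        (Finset.sum_le_sum_of_subset_of_nonneg (Finset.filter_subset _ _) fun _ _ _ => hm0.le)
      rw [Finset.mem_filter] at hq
      rw [Finset.sum_boole]
      refine h.card_tubes_through_le (hYP p hp) (hYP q hq.1) hR ?_
      simpa using hq.2.le_supDist h.S_pos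
    simp only [Finset.sum_const, nsmul_eq_mul] at h3
    rw [div_mul_eq_mul_div, div_le_iff₀ hm0]
    linarith

/-- Richness times the cell multiplicity is controlled by the number of points near the tube. -/
theorem richness_mul_le_tubeCount (h : SpacedConfig S J N s K M P T Tp) {X : Finset (ℤ × ℤ)}
    (hX : X ⊆ P) {i j i₀ : ℕ} (hji : j < i) (hj : j ≤ i₀)
    (I₀ : Finset ((ℤ × ℤ) × (ℤ × ℤ))) {v u : ℝ} (hv0 : 0 ≤ v)
    (hI₀ : ∀ x ∈ I₀, x.1 ∈ X ∧ x.2 ∈ Tp x.1 ∧ (nearCount S N X i₀ x.1 x.2 : ℝ) ≤ v)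
    (hcell : ∀ q ∈ X, u ≤ ((X.filter fun q' => cell S j q' = cell S j q).card : ℝ))
    (hu : 0 ≤ u) {k : ℝ} {x : (ℤ × ℤ) × (ℤ × ℤ)}
    (hk : k ≤ ((X.filter fun q => (q, x.2) ∈ I₀ ∧ Shell S 0 i x.1 q).card : ℝ)) :
    k * u ≤ v * (tubeCount S N X i (6 * (S : ℝ) ^ j) x.1 x.2 : ℝ) := by
  set Z := X.filter fun q => (q, x.2) ∈ I₀ ∧ Shell S 0 i x.1 q with hZ
  set C := Z.image (cell S j) with hC
  have h1 : (Z.card : ℝ) ≤ C.card * v := by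
    rw [Finset.card_eq_sum_card_fiberwise (f := cell S j) (t := C)
      (fun q hq => Finset.mem_image_of_mem _ hq)]
    push_cast
    rw [← nsmul_eq_mul, ← Finset.sum_const]
    refine Finset.sum_le_sum fun c hc => ?_
    obtain ⟨q₀, hq₀, rfl⟩ := Finset.mem_image.1 hc
    rw [hZ, Finset.mem_filter] at hq₀
    refine le_trans (Nat.cast_le.2 (Finset.card_le_card fun q hq => ?_)) (hI₀ _ hq₀.2.1).2.2
    rw [Finset.mem_filter, hZ, Finset.mem_filter] at hq
    obtain ⟨hq1, hq2, -⟩ := hI₀ _ hq.1.2.1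
    refine Finset.mem_filter.2 ⟨hq.1.1, ?_, h.incident q (hX hq1) x.2 hq2⟩
    exact (near_of_cell_eq (cell_eq_mono hj hq.2)).symm
  have h2 : C.card * u ≤ (tubeCount S N X i (6 * (S : ℝ) ^ j) x.1 x.2 : ℝ) := by
    have h3 : ∑ c ∈ C, (X.filter fun q => cell S j q = c).card
        ≤ tubeCount S N X i (6 * (S : ℝ) ^ j) x.1 x.2 := by
      rw [tubeCount, ← Finset.card_biUnion]
      · refine Finset.card_le_card fun q hq => ?_
        obtain ⟨c, hc, hqc⟩ := Finset.mem_biUnion.1 hq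
        obtain ⟨q₀, hq₀, rfl⟩ := Finset.mem_image.1 hc
        rw [hZ, Finset.mem_filter] at hq₀
        rw [Finset.mem_filter] at hqc ⊢
        refine ⟨hqc.1, ?_, ?_⟩
        · have := near_congr (cell_eq_mono hji.le hqc.2) x.1
          exact (this.2 hq₀.2.2.1.symm).symm
        · obtain ⟨hq1, hq2, -⟩ := hI₀ _ hq₀.2.1
          have h4 := h.incident q₀ (hX hq1) x.2 hq2
          have h5 := abs_resid_sub_le h.S_pos h.N_pos (h.slope q₀ (hX hq1) x.2 hq2) hqc.2
          have h6 := abs_sub_abs_le_abs_sub (resid N x.2 q) (resid N x.2 q₀)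
          have h7 := h.one_le_pow j
          linarith
      · intro c _ c' _ hcc
        rw [Function.onFun, Finset.disjoint_left]
        intro q hq hq'
        exact hcc ((Finset.mem_filter.1 hq).2.symm.trans (Finset.mem_filter.1 hq').2)
    refine le_trans ?_ (Nat.cast_le.2 h3)
    push_cast
    rw [← nsmul_eq_mul, ← Finset.sum_const]
    refine Finset.sum_le_sum fun c hc => ?_
    obtain ⟨q₀, hq₀, rfl⟩ := Finset.mem_image.1 hc
    exact hcell q₀ (Finset.mem_filter.1 hq₀).1
  calc k * u ≤ (C.card * v) * u := by gcongr; exact hk.trans h1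
    _ = v * (C.card * u) := by ring
    _ ≤ _ := by gcongr

end SpacedConfig

namespace SpacedConfig

variable {S J N : ℕ} {s K M : ℝ} {P T : Finset (ℤ × ℤ)} {Tp : ℤ × ℤ → Finset (ℤ × ℤ)}

theorem pow_rpow_le (h : SpacedConfig S J N s K M P T Tp) {i : ℕ} (hi : i ≤ J) :
    ((S : ℝ) ^ i) ^ (1 - s) ≤ S * (N : ℝ) ^ (1 - s) := by
  have hS := h.one_le_S
  have hs := h.s_le
  have hs0 := h.s_pos
  calc ((S : ℝ) ^ i) ^ (1 - s) ≤ (S * N : ℝ) ^ (1 - s) := by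
        gcongr
        exact h.pow_le_S_mul_N hi
    _ = (S : ℝ) ^ (1 - s) * (N : ℝ) ^ (1 - s) :=
        Real.mul_rpow (by positivity) (by positivity)
    _ ≤ S * (N : ℝ) ^ (1 - s) := by
        gcongr
        exact Real.rpow_le_self_of_one_le hS (by linarith)

/-- Between the scale `1` and the scale `S ^ l` there is a scale at which the density of points
near a tube drops by a definite factor. -/
theorem exists_dense_scale (h : SpacedConfig S J N s K M P T Tp) {X : Finset (ℤ × ℤ)}
    (hX : X ⊆ P) {l : ℕ} (hl : l ≤ J) (hsm : ¬ SmallScale S N s P l) {c V : ℝ} (hc : 9 * K < c)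
    (hV : V = ((S : ℝ) ^ l) ^ (1 - s) * P.card * (N : ℝ) ^ (s - 2)) (p t : ℤ × ℤ)
    (h0 : 3 ^ J * c * V ≤ (tubeCount S N X l 6 p t : ℝ)) :
    ∃ j < l, c * ((S : ℝ) ^ j * V) ≤ (tubeCount S N X l (6 * (S : ℝ) ^ j) p t : ℝ) ∧
      3 * (tubeCount S N X l (6 * (S : ℝ) ^ (j + 1)) p t : ℝ)
        ≤ S * (tubeCount S N X l (6 * (S : ℝ) ^ j) p t : ℝ) ∧
      (tubeCount S N X l (6 * (S : ℝ) ^ j) p t : ℝ) ≤ 3 ^ J * c * ((S : ℝ) ^ (j + 1) * V) := by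
  have hS := h.S_real_pos
  have hN := h.N_real_pos
  have hP := h.card_pos
  have hK := h.one_le_K
  have hR : (0 : ℝ) < (S : ℝ) ^ l := by positivity
  have hV0 : 0 < V := by rw [hV]; positivity
  set H : ℕ → ℝ := fun j => (tubeCount S N X l (6 * (S : ℝ) ^ j) p t : ℝ) with hH
  have hH0 : H 0 = (tubeCount S N X l 6 p t : ℝ) := by simp [hH]
  have hl' : H l ≤ 9 * K * ((S : ℝ) ^ l * V) := by
    have h1 := h.card_near_large hX hl hsm p
    have h2 : H l ≤ ((X.filter (Near S l p)).card : ℝ) := by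
      refine Nat.cast_le.2 (Finset.card_le_card fun q hq => ?_)
      rw [Finset.mem_filter] at hq ⊢
      exact ⟨hq.1, hq.2.1⟩
    refine (h2.trans h1).trans (le_of_eq ?_)
    have e1 : ((S : ℝ) ^ l) ^ (2 - s) = (S : ℝ) ^ l * ((S : ℝ) ^ l) ^ (1 - s) := by
      rw [show 2 - s = 1 + (1 - s) by ring, Real.rpow_add hR, Real.rpow_one]
    rw [Real.div_rpow hR.le hN.le, e1, hV, show s - 2 = -(2 - s) by ring, Real.rpow_neg hN.le]
    ring
  obtain ⟨j, hj, h1, h2, h3⟩ := exists_descent (a := fun j => H j / ((S : ℝ) ^ j * V)) (c := c)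
    hl (by linarith) (by
      rw [pow_zero, one_mul, le_div_iff₀ hV0, hH0]
      exact h0)
    (lt_of_le_of_lt (by rw [div_le_iff₀ (by positivity)]; exact hl') hc)
  rw [le_div_iff₀ (by positivity)] at h1
  rw [div_le_iff₀ (by positivity)] at h3
  refine ⟨j, hj, h1, ?_, le_trans ?_ h3⟩
  · have h4 := mul_le_mul_of_nonneg_right h2 (show 0 ≤ (S : ℝ) ^ (j + 1) * V by positivity)
    have e1 : 3 * (H (j + 1) / ((S : ℝ) ^ (j + 1) * V)) * ((S : ℝ) ^ (j + 1) * V)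
        = 3 * H (j + 1) := by field_simp
    have e2 : H j / ((S : ℝ) ^ j * V) * ((S : ℝ) ^ (j + 1) * V) = S * H j := by
      rw [pow_succ]; field_simp
    rw [← e1, ← e2]
    exact h4
  · refine Nat.cast_le.2 (tubeCount_mono X l ?_ p t)
    gcongr
    · exact h.one_le_S
    · omega

/-- Many incidences of `X` are rich at a common level `l` and have a density drop at a common
scale `j`. -/
theorem exists_popular_scales (h : SpacedConfig S J N s K M P T Tp) {X : Finset (ℤ × ℤ)}
    (hX : X ⊆ P) (hXne : X.Nonempty) {i₀ : ℕ} (hi₀J : i₀ ≤ J) (hi₀s : SmallScale S N s P i₀)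
    (hbig : ∀ l ≤ J, i₀ < l → ¬ SmallScale S N s P l) {k c : ℝ} {V : ℕ → ℝ}
    (hk : k = M * X.card / (8 * T.card * (J + 1))) (hkv : 1152 * (J + 1) * S * K ^ 2 < k)
    (hV : ∀ l, V l = ((S : ℝ) ^ l) ^ (1 - s) * P.card * (N : ℝ) ^ (s - 2)) (hc : 9 * K < c)
    (hkV : ∀ l ≤ J, 3 ^ J * c * V l ≤ k) :
    ∃ l ≤ J, ∃ j < l, i₀ < l ∧ ∃ I₀ I : Finset ((ℤ × ℤ) × (ℤ × ℤ)), I ⊆ I₀ ∧ I.Nonempty ∧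
      (∀ x ∈ I₀, x.1 ∈ X ∧ x.2 ∈ Tp x.1 ∧
        (nearCount S N X i₀ x.1 x.2 : ℝ) ≤ 1152 * (J + 1) * S * K ^ 2) ∧
      X.card * M ≤ 8 * (J + 1) ^ 2 * I.card ∧
      ∀ x ∈ I, k ≤ ((X.filter fun q => (q, x.2) ∈ I₀ ∧ Shell S 0 l x.1 q).card : ℝ) ∧
        c * ((S : ℝ) ^ j * V l) ≤ (tubeCount S N X l (6 * (S : ℝ) ^ j) x.1 x.2 : ℝ) ∧
        3 * (tubeCount S N X l (6 * (S : ℝ) ^ (j + 1)) x.1 x.2 : ℝ)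
          ≤ S * (tubeCount S N X l (6 * (S : ℝ) ^ j) x.1 x.2 : ℝ) ∧
        (tubeCount S N X l (6 * (S : ℝ) ^ j) x.1 x.2 : ℝ)
          ≤ 3 ^ J * c * ((S : ℝ) ^ (j + 1) * V l) := by
  have hM := h.M_pos
  have hXc : (0 : ℝ) < X.card := by exact_mod_cast Finset.card_pos.2 hXne
  obtain ⟨I₀, I₁, hI₁₀, hI₀, hcard, hlev⟩ := h.exists_incidences hX hi₀J hi₀s
  have hinc : ∀ q t, (q, t) ∈ I₀ → |resid N t q| ≤ 4 := fun q t hqt =>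
    h.incident q (hX (hI₀ _ hqt).1) t (hI₀ _ hqt).2.1
  let r : (ℤ × ℤ) × (ℤ × ℤ) → ℕ × ℕ → Prop := fun x a => i₀ < a.1 ∧ a.2 < a.1 ∧
    k ≤ ((X.filter fun q => (q, x.2) ∈ I₀ ∧ Shell S 0 a.1 x.1 q).card : ℝ) ∧
    c * ((S : ℝ) ^ a.2 * V a.1) ≤ (tubeCount S N X a.1 (6 * (S : ℝ) ^ a.2) x.1 x.2 : ℝ) ∧
    3 * (tubeCount S N X a.1 (6 * (S : ℝ) ^ (a.2 + 1)) x.1 x.2 : ℝ)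
      ≤ S * (tubeCount S N X a.1 (6 * (S : ℝ) ^ a.2) x.1 x.2 : ℝ) ∧
    (tubeCount S N X a.1 (6 * (S : ℝ) ^ a.2) x.1 x.2 : ℝ)
      ≤ 3 ^ J * c * ((S : ℝ) ^ (a.2 + 1) * V a.1)
  have hex : ∀ x ∈ I₁, ∃ a ∈ Finset.range (J + 1) ×ˢ Finset.range (J + 1), r x a := by
    intro x hx
    obtain ⟨l, hl, hkl⟩ := hlev x hx
    rw [← hk] at hkl
    have hil : i₀ < l := by
      by_contra! hli
      refine absurd (hkl.trans (le_trans ?_ (hI₀ x (hI₁₀ hx)).2.2)) (not_le.2 hkv)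
      refine Nat.cast_le.2 (Finset.card_le_card fun q hq => ?_)
      rw [Finset.mem_filter] at hq ⊢
      exact ⟨hq.1, hq.2.2.1.mono h.S_pos hli, hinc _ _ hq.2.1⟩
    obtain ⟨j, hj, h1, h2, h3⟩ := h.exists_dense_scale hX hl (hbig l hl hil) (c := c) hc (hV l) x.1 x.2 (le_trans (hkV l hl) (hkl.trans (Nat.cast_le.2
          (Finset.card_le_card fun q hq => by
            rw [Finset.mem_filter] at hq ⊢
            exact ⟨hq.1, hq.2.2.1, (hinc _ _ hq.2.1).trans (by norm_num)⟩))))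
    exact ⟨(l, j), Finset.mem_product.2 ⟨Finset.mem_range.2 (by omega),
      Finset.mem_range.2 (by dsimp only; omega)⟩, hil, hj, hkl, h1, h2, h3⟩
  obtain ⟨⟨l, j⟩, ha, hpig⟩ := exists_card_le_card_mul_fiber I₁ _ (by simp) r hex
  obtain ⟨I, hmem, hpig⟩ : ∃ I : Finset ((ℤ × ℤ) × (ℤ × ℤ)), (∀ x ∈ I, x ∈ I₁ ∧ r x (l, j)) ∧
      I₁.card ≤ (Finset.range (J + 1) ×ˢ Finset.range (J + 1)).card * I.card :=
    by
    clear_value r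
    exact ⟨_, fun x hx => Finset.mem_filter.1 hx, hpig⟩
  rw [Finset.card_product, Finset.card_range] at hpig
  have hlJ : l ≤ J := by
    have := Finset.mem_range.1 (Finset.mem_product.1 ha).1
    dsimp only at this
    omega
  have hL : X.card * M ≤ 8 * (J + 1) ^ 2 * I.card := by
    refine hcard.trans ?_
    have : (I₁.card : ℝ) ≤ ((J + 1) * (J + 1)) * I.card := by
      exact_mod_cast hpig
    nlinarith
  have hIne : I.Nonempty := by
    rw [Finset.nonempty_iff_ne_empty]
    intro he
    rw [he, Finset.card_empty] at hL
    have : 0 < X.card * M := by positivity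
    simp at hL
    linarith
  obtain ⟨x, hx⟩ := hIne
  obtain ⟨-, hil, hjl, -⟩ := hmem x hx
  exact ⟨l, hlJ, j, hjl, hil, I₀, I, fun x hx => hI₁₀ (hmem x hx).1, ⟨x, hx⟩, hI₀, hL,
    fun x hx => (hmem x hx).2.2.2⟩

/-- The richness bound for a subset all of whose cells of each size have comparable
cardinality. -/
theorem richness_sq_le (h : SpacedConfig S J N s K M P T Tp) {X : Finset (ℤ × ℤ)}
    (hX : X ⊆ P) (hXne : X.Nonempty) {e : ℕ → ℕ}
    (hunif : ∀ j ≤ J, ∀ p ∈ X, S ^ e j ≤ (X.filter fun q => cell S j q = cell S j p).card ∧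
      (X.filter fun q => cell S j q = cell S j p).card ≤ S ^ (e j + 1)) :
    (M * X.card / (8 * T.card * (J + 1))) ^ 2
      ≤ 2 ^ 80 * 9 ^ J * (J + 1) ^ 7 * K ^ 5 * (S : ℝ) ^ 15 * (P.card * (N : ℝ) ^ (-s)) := by
  have hS := h.one_le_S
  have hS0 := h.S_real_pos
  have hN := h.N_real_pos
  have hK := h.one_le_K
  have hM := h.M_pos
  have hP := h.card_pos
  have hT := h.card_T_pos
  have hXc : (0 : ℝ) < X.card := by exact_mod_cast Finset.card_pos.2 hXne
  obtain ⟨k, hk⟩ : ∃ k : ℝ, k = M * X.card / (8 * T.card * (J + 1)) := ⟨_, rfl⟩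
  rw [← hk]
  have hk0 : 0 < k := by rw [hk]; positivity
  obtain ⟨y, hy⟩ : ∃ y : ℝ, y = (J : ℝ) + 1 := ⟨_, rfl⟩
  have hy1 : 1 ≤ y := by rw [hy]; linarith [Nat.cast_nonneg (α := ℝ) J]
  obtain ⟨z, hz⟩ : ∃ z : ℝ, z = (3 : ℝ) ^ J := ⟨_, rfl⟩
  have hz1 : 1 ≤ z := hz ▸ one_le_pow₀ (by norm_num)
  have h9 : (9 : ℝ) ^ J = z ^ 2 := by rw [hz, ← pow_mul, mul_comm, pow_mul]; norm_num
  rw [h9, ← hy]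
  by_contra! hcon
  obtain ⟨v, hv⟩ : ∃ v : ℝ, v = 1152 * y * S * K ^ 2 := ⟨_, rfl⟩
  obtain ⟨c, hc⟩ : ∃ c : ℝ, c = 2 ^ 31 * y ^ 3 * K ^ 2 * (S : ℝ) ^ 5 := ⟨_, rfl⟩
  have hc0 : 9 * K < c := by
    calc 9 * K < 2 ^ 31 * 1 ^ 3 * (K * 1) * 1 ^ 5 := by nlinarith
      _ ≤ c := by
        rw [hc, sq]
        gcongr
  have hcpos : 0 < c := by linarith
  have hkv : v < k := by
    refine lt_of_pow_lt_pow_left₀ 2 hk0.le (lt_of_le_of_lt ?_ hcon)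
    have h1 : 1 / 2 ≤ P.card * (N : ℝ) ^ (-s) := by
      rw [Real.rpow_neg hN.le, ← div_eq_mul_inv, div_le_div_iff₀ (by norm_num) (by positivity)]
      linarith [h.le_card]
    calc v ^ 2 = (1152 ^ 2 * 2) * 1 ^ 2 * y ^ 2 * K ^ 4 * (S : ℝ) ^ 2 * (1 / 2) := by
          rw [hv]; ring
      _ ≤ 2 ^ 80 * z ^ 2 * y ^ 7 * K ^ 5 * (S : ℝ) ^ 15 * (P.card * (N : ℝ) ^ (-s)) := by
          gcongr <;> norm_num
  have hkV : ∀ l ≤ J, z * c * (((S : ℝ) ^ l) ^ (1 - s) * P.card * (N : ℝ) ^ (s - 2)) ≤ k := by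
    intro l hl
    have h1 : ((S : ℝ) ^ l) ^ (1 - s) * P.card * (N : ℝ) ^ (s - 2) ≤ S * P.card * (N : ℝ)⁻¹ := by
      calc ((S : ℝ) ^ l) ^ (1 - s) * P.card * (N : ℝ) ^ (s - 2)
          ≤ (S * (N : ℝ) ^ (1 - s)) * P.card * (N : ℝ) ^ (s - 2) := by
            gcongr
            exact h.pow_rpow_le hl
        _ = S * P.card * ((N : ℝ) ^ (1 - s) * (N : ℝ) ^ (s - 2)) := by ring
        _ = S * P.card * (N : ℝ)⁻¹ := by
            rw [← Real.rpow_add hN, show 1 - s + (s - 2) = -1 by ring, Real.rpow_neg_one]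
    refine (mul_le_mul_of_nonneg_left h1 (by positivity)).trans ?_
    refine le_of_pow_le_pow_left₀ two_ne_zero hk0.le (le_trans ?_ hcon.le)
    have h2 : P.card * (N : ℝ)⁻¹ ^ 2 ≤ 2 * (N : ℝ) ^ (-s) := by
      have e1 : (N : ℝ) ^ (2 - s) * (N : ℝ)⁻¹ ^ 2 = (N : ℝ) ^ (-s) := by
        rw [sub_eq_add_neg, Real.rpow_add hN, Real.rpow_two]
        field_simp
      rw [← e1, ← mul_assoc]
      gcongr
      exact h.card_le
    calc (z * c * (S * P.card * (N : ℝ)⁻¹)) ^ 2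
        = (z * c * S) ^ 2 * P.card * (P.card * (N : ℝ)⁻¹ ^ 2) := by ring
      _ ≤ (z * c * S) ^ 2 * P.card * (2 * (N : ℝ) ^ (-s)) := by gcongr
      _ = 2 ^ 63 * z ^ 2 * y ^ 6 * K ^ 4 * (S : ℝ) ^ 12 * (P.card * (N : ℝ) ^ (-s)) := by
          rw [hc]; ring
      _ ≤ _ := by gcongr <;> norm_num
  obtain ⟨V, hV⟩ : ∃ V : ℕ → ℝ, ∀ l, V l = ((S : ℝ) ^ l) ^ (1 - s) * P.card * (N : ℝ) ^ (s - 2) :=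
    ⟨_, fun _ => rfl⟩
  obtain ⟨i₀, hi₀J, hi₀s, hbig⟩ : ∃ i₀ ≤ J, SmallScale S N s P i₀ ∧
      ∀ l ≤ J, i₀ < l → ¬ SmallScale S N s P l :=
    ⟨Nat.findGreatest (SmallScale S N s P) J, Nat.findGreatest_le J,
      Nat.findGreatest_spec (Nat.zero_le J) h.smallScale_zero, fun l hl hil =>
        Nat.findGreatest_is_greatest hil hl⟩
  obtain ⟨l, hlJ, j, hjl, hil, I₀, I, hII₀, ⟨x, hx⟩, hI₀, hL, hI⟩ :=
    h.exists_popular_scales hX hXne hi₀J hi₀s hbig hk (by rw [← hy, ← hv]; exact hkv) hV hc0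
      (fun l hl => by rw [hV, ← hz]; exact hkV l hl)
  rw [← hy, ← hv] at hI₀
  rw [← hy] at hL
  rw [← hz] at hI
  have hIX : ∀ x ∈ I, x.1 ∈ X ∧ x.2 ∈ Tp x.1 := fun x hx =>
    ⟨(hI₀ x (hII₀ hx)).1, (hI₀ x (hII₀ hx)).2.1⟩
  have hdense := fun x hx => (hI x hx).2.2.1
  have hV0 : 0 < V l := by rw [hV]; positivity
  rcases lt_or_ge i₀ j with hij | hij
  · have h1 := h.density_le_of_large hX hXne hlJ hjl (hbig j (hjl.le.trans hlJ) hij) I hIX hdense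
      (H := c * ((S : ℝ) ^ j * V l)) (L := 8 * y ^ 2) (by positivity) (by positivity)
      (fun x hx => (hI x hx).2.1) hL
    rw [← hV] at h1
    have h2 := le_of_mul_le_mul_right h1 (by positivity)
    have h3 : 0 < y ^ 3 * K ^ 2 * (S : ℝ) ^ 5 := by positivity
    rw [hc, ← hy] at h2
    nlinarith
  · obtain ⟨hu1, hu2⟩ : (∀ q ∈ X, (S : ℝ) ^ e j
        ≤ ((X.filter fun q' => cell S j q' = cell S j q).card : ℝ)) ∧
        ∀ q ∈ X, ((X.filter fun q' => cell S j q' = cell S j q).card : ℝ)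
          ≤ (S : ℝ) ^ (e j + 1) :=
      ⟨fun q hq => by exact_mod_cast (hunif j (hjl.le.trans hlJ) q hq).1,
        fun q hq => by exact_mod_cast (hunif j (hjl.le.trans hlJ) q hq).2⟩
    obtain ⟨u, hu⟩ : ∃ u : ℝ, u = (S : ℝ) ^ e j := ⟨_, rfl⟩
    rw [← hu] at hu1
    have hu0 : 0 < u := by rw [hu]; positivity
    have h1 := h.richness_le_of_card_cell_le hX hXne hlJ hjl I hIX hdense (k := k)
      (L := 8 * y ^ 2) hk0.le (by positivity) (by positivity) hu2
      (fun x hx => by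
        refine (hI x hx).1.trans (Nat.cast_le.2 (Finset.card_le_card fun q hq => ?_))
        rw [Finset.mem_filter] at hq ⊢
        have hq2 := hI₀ _ hq.2.1
        exact ⟨hq.1, h.incident q (hX hq2.1) x.2 hq2.2.1, hq.2.2⟩) hL
    have h2 := h.richness_mul_le_tubeCount hX hjl hij I₀ (by rw [hv]; positivity) hI₀ hu1 hu0.le
      (hI x hx).1
    rw [← hy] at h1
    have h3 : k * u ≤ v * (z * c * ((S : ℝ) ^ (j + 1) * V l)) :=
      h2.trans (mul_le_mul_of_nonneg_left (hI x hx).2.2.2 (by rw [hv]; positivity))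
    obtain ⟨R, hR⟩ : ∃ R : ℝ, R = ((S : ℝ) ^ l) ^ (1 - s) := ⟨_, rfl⟩
    rw [← hR] at h1
    have hR0 : 0 < R := by rw [hR]; positivity
    have h4 : k ^ 2 ≤ 4096770048 * (8 * y ^ 2) * y * K * (S : ℝ) ^ 5 * (R * S) *
        (v * (z * c * (S * V l))) := by
      refine le_of_mul_le_mul_right (a := (S : ℝ) ^ j * u) ?_ (by positivity)
      calc k ^ 2 * ((S : ℝ) ^ j * u) = (k * (S : ℝ) ^ j) * (k * u) := by ring
        _ ≤ _ := mul_le_mul h1 h3 (by positivity) (by positivity)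
        _ = _ := by rw [hu]; ring
    refine absurd (h4.trans ?_) (not_le.2 hcon)
    have h5 : R * V l ≤ (S : ℝ) ^ 2 * (P.card * (N : ℝ) ^ (-s)) := by
      have hR2 := h.pow_rpow_le hlJ
      rw [← hR] at hR2
      calc R * V l = R * R * (P.card * (N : ℝ) ^ (s - 2)) := by rw [hV, ← hR]; ring
        _ ≤ (S * (N : ℝ) ^ (1 - s)) * (S * (N : ℝ) ^ (1 - s)) * (P.card * (N : ℝ) ^ (s - 2)) := by
            gcongr
        _ = (S : ℝ) ^ 2 * (P.card * ((N : ℝ) ^ (1 - s) * (N : ℝ) ^ (1 - s) * (N : ℝ) ^ (s - 2))) := by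
            ring
        _ = _ := by
            rw [← Real.rpow_add hN, ← Real.rpow_add hN,
              show 1 - s + (1 - s) + (s - 2) = -s by ring]
    calc 4096770048 * (8 * y ^ 2) * y * K * (S : ℝ) ^ 5 * (R * S) * (v * (z * c * (S * V l)))
        = (4096770048 * 8 * 1152 * 2 ^ 31) * z ^ 1 * y ^ 7 * K ^ 5 * (S : ℝ) ^ 13 * (R * V l) := by
          rw [hv, hc]; ring
      _ ≤ 2 ^ 80 * z ^ 2 * y ^ 7 * K ^ 5 * (S : ℝ) ^ 13 *
          ((S : ℝ) ^ 2 * (P.card * (N : ℝ) ^ (-s))) := by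
          gcongr
          · norm_num
          · norm_num
      _ = _ := by ring

/-- The main lower bound for the number of tubes of a spaced configuration. -/
theorem card_tubes_lower_bound (h : SpacedConfig S J N s K M P T Tp) :
    (M * P.card / (8 * (2 * J + 1) ^ (J + 1) * (J + 1) * T.card)) ^ 2
      ≤ 2 ^ 80 * 9 ^ J * (J + 1) ^ 7 * K ^ 5 * (S : ℝ) ^ 15 * (P.card * (N : ℝ) ^ (-s)) := by
  have hM := h.M_pos
  have hT := h.card_T_pos
  have hPc : P.card < S ^ (2 * J + 1) := by
    have h1 : P ⊆ Finset.Ico (0 : ℤ) N ×ˢ Finset.Ico (0 : ℤ) N := fun p hp => by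
      obtain ⟨a, b, c, d⟩ := h.box p hp
      exact Finset.mem_product.2 ⟨Finset.mem_Ico.2 ⟨a, b⟩, Finset.mem_Ico.2 ⟨c, d⟩⟩
    have h2 := Finset.card_le_card h1
    rw [Finset.card_product, Int.card_Ico, sub_zero, Int.toNat_natCast] at h2
    calc P.card ≤ N * N := h2
      _ ≤ S ^ J * S ^ J := Nat.mul_le_mul h.N_le h.N_le
      _ = S ^ (2 * J) := by rw [← pow_add]; congr 1; ring
      _ < S ^ (2 * J + 1) := Nat.pow_lt_pow_right h.two_le (by omega)
  obtain ⟨X, hX, hcard, e, he⟩ := exists_uniform_subset (by omega) h.two_le P hPc (J + 1)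
  have hXne : X.Nonempty := by
    rw [← Finset.card_pos]
    have := Finset.card_pos.2 h.nonempty
    exact Nat.pos_of_ne_zero fun h0 => by rw [h0] at hcard; omega
  refine le_trans ?_ (h.richness_sq_le hX hXne (e := e) fun j hj p hp =>
    ⟨(he j (by omega) p hp).1, (he j (by omega) p hp).2.le⟩)
  have hcard' : (P.card : ℝ) ≤ (2 * J + 1) ^ (J + 1) * X.card := by exact_mod_cast hcard
  gcongr ?_ ^ 2
  rw [div_le_div_iff₀ (by positivity) (by positivity)]
  calc M * P.card * (8 * T.card * (J + 1))
      ≤ M * ((2 * J + 1) ^ (J + 1) * X.card) * (8 * T.card * (J + 1)) := by gcongr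
    _ = _ := by ring

end SpacedConfig

/-! ### From dyadic squares and tubes to integer coordinates -/

theorem eq_of_mem_dSq {δ : ℝ} (hδ : 0 < δ) {q q' : ℤ × ℤ} {z : ℝ × ℝ} (h : z ∈ dSq δ q)
    (h' : z ∈ dSq δ q') : q = q' := by
  have key : ∀ (a b : ℤ) (x : ℝ), x ∈ Set.Ico ((a : ℝ) * δ) (((a : ℝ) + 1) * δ) →
      x ∈ Set.Ico ((b : ℝ) * δ) (((b : ℝ) + 1) * δ) → a ≤ b := by
    intro a b x hx hx'
    have h1 : (a : ℝ) < b + 1 := lt_of_mul_lt_mul_right (hx.1.trans_lt hx'.2) hδ.le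
    exact Int.lt_add_one_iff.1 (by exact_mod_cast h1)
  exact Prod.ext (le_antisymm (key _ _ _ h.1 h'.1) (key _ _ _ h'.1 h.1))
    (le_antisymm (key _ _ _ h.2 h'.2) (key _ _ _ h'.2 h.2))

theorem corner_mem_dSq {δ : ℝ} (hδ : 0 < δ) (q : ℤ × ℤ) :
    ((q.1 : ℝ) * δ, (q.2 : ℝ) * δ) ∈ dSq δ q := by
  constructor <;> constructor <;> dsimp only <;> nlinarith

theorem mem_of_dSq_inter_sqUnion_nonempty {δ : ℝ} (hδ : 0 < δ) {X : Finset (ℤ × ℤ)}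
    {B : Set (ℝ × ℝ)} {q : ℤ × ℤ} (h : (dSq δ q ∩ (sqUnion δ X ∩ B)).Nonempty) : q ∈ X := by
  obtain ⟨z, hz, hzX, -⟩ := h
  obtain ⟨p, hp, hzp⟩ := Set.mem_iUnion₂.1 hzX
  rwa [eq_of_mem_dSq hδ hz hzp]

/-- Squares of `X` whose corner lies in `B` are counted by the covering number of the part of the
union of `X` in `B`. -/
theorem card_le_covNum {δ : ℝ} (hδ : 0 < δ) {X F : Finset (ℤ × ℤ)} {B : Set (ℝ × ℝ)}
    (hFX : F ⊆ X) (hF : ∀ q ∈ F, ((q.1 : ℝ) * δ, (q.2 : ℝ) * δ) ∈ B) :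
    F.card ≤ covNum δ (sqUnion δ X ∩ B) := by
  have hfin : {q : ℤ × ℤ | (dSq δ q ∩ (sqUnion δ X ∩ B)).Nonempty}.Finite :=
    X.finite_toSet.subset fun q hq => mem_of_dSq_inter_sqUnion_nonempty hδ hq
  rw [covNum, ← Set.ncard_coe_finset F]
  refine Set.ncard_le_ncard (fun q hq => ?_) hfin
  refine ⟨_, corner_mem_dSq hδ q, Set.mem_iUnion₂.2 ⟨q, hFX hq, corner_mem_dSq hδ q⟩, hF q hq⟩

theorem covNum_sqUnion_le {δ : ℝ} (hδ : 0 < δ) (X : Finset (ℤ × ℤ)) :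
    covNum δ (sqUnion δ X) ≤ X.card := by
  rw [covNum, ← Set.ncard_coe_finset X]
  refine Set.ncard_le_ncard (fun q hq => ?_) X.finite_toSet
  refine mem_of_dSq_inter_sqUnion_nonempty (B := Set.univ) hδ ?_
  rwa [Set.inter_univ]

theorem abs_resid_le_of_nonempty {N : ℕ} (hN : 0 < N) {p t : ℤ × ℤ} (hp : 0 ≤ p.1)
    (hpN : p.1 < N) (ht : |(t.1 : ℝ)| ≤ N)
    (h : (dTube (N : ℝ)⁻¹ t ∩ dSq (N : ℝ)⁻¹ p).Nonempty) : |resid N t p| ≤ 4 := by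
  obtain ⟨z, ⟨ab, hab, hz⟩, hzp⟩ := h
  have hN' : (0 : ℝ) < N := by exact_mod_cast hN
  have key : ∀ (k : ℤ) (x : ℝ), x ∈ Set.Ico ((k : ℝ) * (N : ℝ)⁻¹) (((k : ℝ) + 1) * (N : ℝ)⁻¹) →
      ∃ u : ℝ, 0 ≤ u ∧ u < 1 ∧ x = (k + u) / N := by
    intro k x hx
    rw [← div_eq_mul_inv, ← div_eq_mul_inv, Set.mem_Ico, div_le_iff₀ hN', lt_div_iff₀ hN'] at hx
    exact ⟨x * N - k, by linarith, by linarith, by field_simp; ring⟩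
  obtain ⟨u, hu0, hu1, hu⟩ := key _ _ hzp.1
  obtain ⟨w, hw0, hw1, hw⟩ := key _ _ hzp.2
  obtain ⟨α, hα0, hα1, hα⟩ := key _ _ hab.1
  obtain ⟨β, hβ0, hβ1, hβ⟩ := key _ _ hab.2
  rw [hu, hw, hα, hβ] at hz
  set g : ℝ := (t.1 : ℝ) / N with hg
  set y : ℝ := (p.1 + u) / N with hy
  have hy0 : 0 ≤ y := by
    have : (0 : ℝ) ≤ p.1 := by exact_mod_cast hp
    positivity
  have hy1 : y ≤ 1 := by
    have : (p.1 : ℝ) + 1 ≤ N := by exact_mod_cast hpN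
    rw [hy, div_le_one hN']
    linarith
  have hg1 : |g| ≤ 1 := by rwa [hg, abs_div, abs_of_pos hN', div_le_one hN']
  have e : resid N t p = -w + g * u + α * y + β := by
    have e1 : (p.2 : ℝ) + w = g * (p.1 + u) + α * y + t.2 + β := by
      have e2 : g * (p.1 + u) = t.1 * y := by rw [hg, hy]; ring
      field_simp at hz
      rw [e2]
      linarith
    rw [resid, ← hg]
    linarith
  obtain ⟨hg2, hg3⟩ := abs_le.1 hg1
  rw [e, abs_le]
  constructor <;> nlinarith [mul_nonneg hα0 hy0]

/-- The tubes of a nice configuration through a fixed square satisfy the direction spacing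
condition. -/
theorem card_direction_le {N : ℕ} (hN : 0 < N) {s C M : ℝ} (hs0 : 0 < s) (hs1 : s ≤ 1)
    (hC : 1 ≤ C) {p : ℤ × ℤ} {X : Finset (ℤ × ℤ)} (hp : 0 ≤ p.1) (hpN : p.1 < N)
    (hinc : ∀ t ∈ X, |resid N t p| ≤ 4) (hX : IsDSSet (N : ℝ)⁻¹ s C (sqUnion (N : ℝ)⁻¹ X))
    (hM : (X.card : ℝ) ≤ 2 * M) (a ρ : ℝ) (hρ : 1 ≤ ρ) :
    ((X.filter fun t => |(t.1 : ℝ) - a| ≤ ρ).card : ℝ) ≤ 12 * C * (ρ / N) ^ s * M := by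
  have hN' : (0 : ℝ) < N := by exact_mod_cast hN
  have hM0 : 0 ≤ M := by linarith [Nat.cast_nonneg (α := ℝ) X.card]
  set r : ℝ := 6 * (ρ / N) with hr
  have hr0 : 0 < r := by positivity
  have hrs : r ^ s ≤ 6 * (ρ / N) ^ s := by
    rw [hr, Real.mul_rpow (by norm_num) (by positivity)]
    gcongr
    exact Real.rpow_le_self_of_one_le (by norm_num) hs1
  set F := X.filter fun t => |(t.1 : ℝ) - a| ≤ ρ with hF
  have hmain : (F.card : ℝ) ≤ C * r ^ s * (2 * M) := by
    rcases le_or_gt r 1 with hr1 | hr1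
    · set b : ℝ := p.2 - a / N * p.1 with hb
      have h1 := hX (a * (N : ℝ)⁻¹, b * (N : ℝ)⁻¹) r (by
        have : (N : ℝ)⁻¹ ≤ ρ * (N : ℝ)⁻¹ := le_mul_of_one_le_left (by positivity) hρ
        have h0 : 0 < (N : ℝ)⁻¹ := by positivity
        rw [hr, div_eq_mul_inv]
        linarith) hr1
      have h2 : F.card ≤ covNum (N : ℝ)⁻¹ (sqUnion (N : ℝ)⁻¹ X ∩
          Metric.ball (a * (N : ℝ)⁻¹, b * (N : ℝ)⁻¹) r) := by
        refine card_le_covNum (by positivity) (Finset.filter_subset _ _) fun t ht => ?_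
        rw [hF, Finset.mem_filter] at ht
        have hpN' : (p.1 : ℝ) / N ≤ 1 := by
          rw [div_le_one hN']; exact_mod_cast hpN.le
        have hp0 : 0 ≤ (p.1 : ℝ) / N := by
          have : (0 : ℝ) ≤ p.1 := by exact_mod_cast hp
          positivity
        have h3 : |(t.2 : ℝ) - b| ≤ ρ + 4 := by
          have e : (t.2 : ℝ) - b = -(resid N t p) - ((t.1 : ℝ) - a) * (p.1 / N) := by
            rw [hb, resid]; ring
          rw [e]
          refine (abs_sub _ _).trans ?_
          rw [abs_neg, abs_mul, abs_of_nonneg hp0]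
          have := hinc t ht.1
          have h4 : |(t.1 : ℝ) - a| * (p.1 / N) ≤ ρ * 1 :=
            mul_le_mul ht.2 hpN' hp0 (by linarith)
          linarith
        have h5 : ∀ x y : ℝ, |x - y| ≤ ρ + 4 → dist (x * (N : ℝ)⁻¹) (y * (N : ℝ)⁻¹) < r := by
          intro x y hxy
          rw [Real.dist_eq, ← sub_mul, abs_mul, abs_of_pos (inv_pos.2 hN'), ← div_eq_mul_inv, hr,
            ← mul_div_assoc]
          gcongr
          linarith
        rw [Metric.mem_ball, Prod.dist_eq]
        exact max_lt (h5 _ _ (by linarith [ht.2])) (h5 _ _ h3)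
      have h3 : (covNum (N : ℝ)⁻¹ (sqUnion (N : ℝ)⁻¹ X) : ℝ) ≤ X.card := by
        exact_mod_cast covNum_sqUnion_le (by positivity) X
      calc (F.card : ℝ) ≤ _ := Nat.cast_le.2 h2
        _ ≤ _ := h1
        _ ≤ C * r ^ s * (2 * M) := by
            gcongr
            linarith
    · have h1 : 1 ≤ r ^ s := Real.one_le_rpow hr1.le hs0.le
      have h2 : (F.card : ℝ) ≤ X.card := by exact_mod_cast Finset.card_le_card (Finset.filter_subset _ _)
      have h3 : 1 * (2 * M) ≤ C * r ^ s * (2 * M) := by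
        gcongr
        nlinarith
      linarith
  calc (F.card : ℝ) ≤ C * r ^ s * (2 * M) := hmain
    _ ≤ C * (6 * (ρ / N) ^ s) * (2 * M) := by gcongr
    _ = _ := by ring

/-- The point spacing condition in integer coordinates. -/
theorem card_cell_le_of_covNum_le {n m i : ℕ} {s C : ℝ} (hs : s ≤ 1) (hC : 1 ≤ C)
    {P : Finset (ℤ × ℤ)} {p : ℤ × ℤ} (hp : p ∈ P)
    (h : ∀ (j : ℕ) (ρ : ℝ), ρ = 2 ^ (-(j : ℤ)) → ((2 ^ n : ℕ) : ℝ)⁻¹ ≤ ρ → ∀ Q : ℤ × ℤ,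
      (dSq ρ Q ∩ sqUnion ((2 ^ n : ℕ) : ℝ)⁻¹ P).Nonempty →
      (covNum ((2 ^ n : ℕ) : ℝ)⁻¹ (sqUnion ((2 ^ n : ℕ) : ℝ)⁻¹ P ∩ dSq ρ Q) : ℝ) ≤
        C * max (ρ ^ (2 - s) * (P.card : ℝ)) ((ρ / ((2 ^ n : ℕ) : ℝ)⁻¹) ^ s)) :
    ((P.filter fun q => cell (2 ^ m) i q = cell (2 ^ m) i p).card : ℝ) ≤
      C * max (((((2 ^ m : ℕ) : ℝ) ^ i) / (2 ^ n : ℕ)) ^ (2 - s) * P.card)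
        ((((2 ^ m : ℕ) : ℝ) ^ i) ^ s) := by
  set δ : ℝ := ((2 ^ n : ℕ) : ℝ)⁻¹ with hδ
  have hδ0 : 0 < δ := by positivity
  set R : ℝ := ((2 ^ m : ℕ) : ℝ) ^ i with hR
  have hR0 : 0 < R := by positivity
  have hR2 : R = 2 ^ (m * i) := by rw [hR]; push_cast; rw [pow_mul]
  set F := P.filter fun q => cell (2 ^ m) i q = cell (2 ^ m) i p with hF
  rcases le_or_gt (m * i) n with hmi | hmi
  · set ρ : ℝ := R / (2 ^ n : ℕ) with hρ
    have hρδ : ρ = R * δ := by rw [hρ, hδ, div_eq_mul_inv]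
    have hR1 : 1 ≤ R := by rw [hR2]; exact one_le_pow₀ (by norm_num)
    have hρj : ρ = 2 ^ (-((n - m * i : ℕ) : ℤ)) := by
      rw [zpow_neg, zpow_natCast, hρ, hR2, Nat.cast_pow, Nat.cast_ofNat, eq_comm, inv_eq_one_div,
        div_eq_div_iff (by positivity) (by positivity), one_mul, ← pow_add]
      congr 1
      omega
    set Q := cell (2 ^ m) i p with hQ
    have hmem : ∀ q ∈ F, ((q.1 : ℝ) * δ, (q.2 : ℝ) * δ) ∈ dSq ρ Q := by
      intro q hq
      rw [hF, Finset.mem_filter] at hq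
      have key : ∀ x : ℤ, (x : ℝ) * δ ∈ Set.Ico (((x / ((2 ^ m : ℕ) : ℤ) ^ i : ℤ) : ℝ) * ρ)
          ((((x / ((2 ^ m : ℕ) : ℤ) ^ i : ℤ) : ℝ) + 1) * ρ) := by
        intro x
        have hpos : (0 : ℤ) < ((2 ^ m : ℕ) : ℤ) ^ i := by positivity
        have h1 := Int.ediv_mul_le x hpos.ne'
        have h2 := Int.lt_ediv_add_one_mul_self x hpos
        set d := x / ((2 ^ m : ℕ) : ℤ) ^ i with hd
        have h1' : (d : ℝ) * R ≤ x := by rw [hR]; exact_mod_cast h1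
        have h2' : (x : ℝ) < (d + 1) * R := by rw [hR]; exact_mod_cast h2
        rw [hρδ, ← mul_assoc, ← mul_assoc]
        exact ⟨mul_le_mul_of_nonneg_right h1' hδ0.le, mul_lt_mul_of_pos_right h2' hδ0⟩
      rw [← hq.2]
      exact ⟨key q.1, key q.2⟩
    have hpF : p ∈ F := Finset.mem_filter.2 ⟨hp, rfl⟩
    have h1 := h (n - m * i) ρ hρj (by rw [hρδ]; exact le_mul_of_one_le_left hδ0.le hR1) Q
      ⟨_, hmem p hpF, Set.mem_iUnion₂.2 ⟨p, hp, corner_mem_dSq hδ0 p⟩⟩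
    have e : ρ / δ = R := by rw [hρδ]; field_simp
    rw [e] at h1
    exact le_trans (Nat.cast_le.2 (card_le_covNum hδ0 (Finset.filter_subset _ _) hmem)) h1
  · have h1 : (F.card : ℝ) ≤ P.card := by exact_mod_cast Finset.card_le_card (Finset.filter_subset _ _)
    have h2 : 1 ≤ R / (2 ^ n : ℕ) := by
      rw [one_le_div (by positivity), hR2, Nat.cast_pow, Nat.cast_ofNat]
      exact pow_le_pow_right₀ (by norm_num) hmi.le
    have h3 : 1 ≤ (R / (2 ^ n : ℕ)) ^ (2 - s) := Real.one_le_rpow h2 (by linarith)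
    have h0 : (0 : ℝ) ≤ P.card := Nat.cast_nonneg _
    calc (F.card : ℝ) ≤ 1 * (1 * P.card) := by linarith
      _ ≤ C * ((R / (2 ^ n : ℕ)) ^ (2 - s) * P.card) := by gcongr
      _ ≤ _ := by gcongr; exact le_max_left _ _

/-- A nice configuration with the spacing condition is a spaced configuration. -/
theorem NiceConfig.spacedConfig {n m J M : ℕ} {s t A C δ : ℝ} (hδ : δ = ((2 ^ n : ℕ) : ℝ)⁻¹)
    (hm : 1 ≤ m) (hnm : n ≤ m * J) (hmn : m * J ≤ m + n) (hs0 : 0 < s) (hs1 : s ≤ 1)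
    (hts : s ≤ t) (ht : t ≤ 2 - s) (hA : 1 ≤ A) (hC : 1 ≤ C) (hM : 0 < M)
    {P T : Finset (ℤ × ℤ)} {Tp : ℤ × ℤ → Finset (ℤ × ℤ)} (h : NiceConfig δ s C M P T Tp)
    (hP1 : δ ^ (-t) ≤ 2 * (P.card : ℝ)) (hP2 : (P.card : ℝ) ≤ 2 * δ ^ (-t))
    (hsp : ∀ (j : ℕ) (ρ : ℝ), ρ = 2 ^ (-(j : ℤ)) → δ ≤ ρ →
      ∀ Q : ℤ × ℤ, (dSq ρ Q ∩ sqUnion δ P).Nonempty →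
        (covNum δ (sqUnion δ P ∩ dSq ρ Q) : ℝ) ≤
          A * C * max (ρ ^ (2 - s) * (P.card : ℝ)) ((ρ / δ) ^ s)) :
    SpacedConfig (2 ^ m) J (2 ^ n) s (12 * (A * C)) M P T Tp := by
  subst hδ
  set N : ℕ := 2 ^ n with hN
  have hN0 : 0 < N := by positivity
  have hN' : (0 : ℝ) < N := by exact_mod_cast hN0
  have hN1 : (1 : ℝ) ≤ N := by exact_mod_cast hN0
  have hAC : 1 ≤ A * C := by nlinarith
  have hpow : ((N : ℝ)⁻¹) ^ (-t) = (N : ℝ) ^ t := by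
    rw [Real.inv_rpow hN'.le, Real.rpow_neg hN'.le, inv_inv]
  rw [hpow] at hP1 hP2
  obtain ⟨hunit, htube, hpt⟩ := h
  have hbox : ∀ p ∈ P, 0 ≤ p.1 ∧ p.1 < N ∧ 0 ≤ p.2 ∧ p.2 < N := by
    intro p hp
    obtain ⟨⟨h1, h2⟩, h3, h4⟩ := hunit p hp (corner_mem_dSq (inv_pos.2 hN') p)
    dsimp only at h1 h2 h3 h4
    rw [← div_eq_mul_inv] at h1 h2 h3 h4
    rw [div_lt_one hN'] at h2 h4
    rw [le_div_iff₀ hN', zero_mul] at h1 h3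
    exact ⟨by exact_mod_cast h1, by exact_mod_cast h2, by exact_mod_cast h3, by exact_mod_cast h4⟩
  have hslope : ∀ p ∈ P, ∀ t ∈ Tp p, |(t.1 : ℝ)| ≤ N := by
    intro p hp t ht
    obtain ⟨h1, h2⟩ := htube t ((hpt p hp).1 ht)
    rw [← div_eq_mul_inv] at h1 h2
    rw [le_div_iff₀ hN'] at h1
    rw [div_le_one hN'] at h2
    rw [abs_le]
    constructor <;> linarith
  have hinc : ∀ p ∈ P, ∀ t ∈ Tp p, |resid N t p| ≤ 4 := fun p hp t ht =>
    abs_resid_le_of_nonempty hN0 (hbox p hp).1 (hbox p hp).2.1 (hslope p hp t ht)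
      ((hpt p hp).2.2.2.2 t ht)
  refine
    { two_le := ?_, N_pos := hN0, N_le := ?_, le_N := ?_, s_pos := hs0, s_le := hs1,
      one_le_K := by linarith, M_pos := by exact_mod_cast hM, nonempty := ?_, box := hbox,
      subset := fun p hp => (hpt p hp).1, slope := hslope, incident := hinc, direction := ?_,
      card_tubes := fun p hp => by linarith [(hpt p hp).2.2.1], spacing := ?_,
      card_le := ?_, le_card := ?_ }
  · calc 2 = 2 ^ 1 := rfl
      _ ≤ 2 ^ m := Nat.pow_le_pow_right (by norm_num) hm
  · rw [← pow_mul]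
    exact Nat.pow_le_pow_right (by norm_num) hnm
  · rw [← pow_mul, hN, ← pow_add]
    exact Nat.pow_le_pow_right (by norm_num) hmn
  · rw [← Finset.card_pos, ← Nat.cast_pos (α := ℝ)]
    have : 0 < (N : ℝ) ^ t := by positivity
    linarith
  · intro p hp a ρ hρ
    refine (card_direction_le hN0 hs0 hs1 hC (hbox p hp).1 (hbox p hp).2.1 (hinc p hp)
      (hpt p hp).2.1 (hpt p hp).2.2.2.1 a ρ hρ).trans ?_
    gcongr
    nlinarith
  · intro p hp i _
    refine (card_cell_le_of_covNum_le hs1 hAC hp hsp).trans ?_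
    gcongr ?_ * _
    linarith
  · refine hP2.trans ?_
    gcongr
  · refine le_trans ?_ hP1
    gcongr

theorem exists_nat_mul_between {n J : ℕ} (hJ : 0 < J) (hn : J * J ≤ n) :
    ∃ m, 1 ≤ m ∧ n ≤ m * J ∧ m * J ≤ m + n := by
  have h1 := Nat.div_add_mod n J
  have h2 := Nat.mod_lt n hJ
  have h3 : J ≤ n / J := (Nat.le_div_iff_mul_le hJ).2 hn
  have h4 : (n / J + 1) * J = J * (n / J) + J := by ring
  refine ⟨n / J + 1, by omega, ?_, ?_⟩ <;> rw [h4] <;> linarith [Nat.mul_div_le n J]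

theorem SpacedConfig.pow_fifteen_le {S J N : ℕ} {s K M ε : ℝ} {P T : Finset (ℤ × ℤ)}
    {Tp : ℤ × ℤ → Finset (ℤ × ℤ)} (h : SpacedConfig S (J + 1) N s K M P T Tp) (hε : 0 < ε)
    (hJ : 15 ≤ ε * J) : (S : ℝ) ^ 15 ≤ (N : ℝ) ^ ε := by
  have hS := h.one_le_S
  have hS0 := h.S_real_pos
  have h1 : (S : ℝ) ^ J ≤ N := by
    have : (S : ℝ) ^ (J + 1) ≤ S * N := by exact_mod_cast h.le_N
    rw [pow_succ'] at this
    exact le_of_mul_le_mul_left this hS0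
  calc (S : ℝ) ^ 15 = (S : ℝ) ^ (15 : ℝ) := by norm_cast
    _ ≤ (S : ℝ) ^ (J * ε) := Real.rpow_le_rpow_of_exponent_le hS (by linarith)
    _ = ((S : ℝ) ^ J) ^ ε := by rw [Real.rpow_mul hS0.le, Real.rpow_natCast]
    _ ≤ (N : ℝ) ^ ε := by gcongr

/-- The lower bound for the number of tubes with the constants spelled out. -/
theorem SpacedConfig.card_tubes_ge {S J N : ℕ} {s t ε η a M : ℝ} {P T : Finset (ℤ × ℤ)}
    {Tp : ℤ × ℤ → Finset (ℤ × ℤ)} (ha : 0 < a)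
    (h : SpacedConfig S (J + 1) N s (a * (N : ℝ) ^ η) M P T Tp) (hε : 0 < ε)
    (hJ : 15 ≤ ε * J) (hη : 5 * η ≤ ε) (hP : (N : ℝ) ^ t ≤ 2 * P.card) {E B : ℝ}
    (hE : E = 8 * (2 * (J + 1 : ℕ) + 1) ^ (J + 1 + 1) * ((J + 1 : ℕ) + 1))
    (hB : B = 2 ^ 80 * 9 ^ (J + 1) * ((J + 1 : ℕ) + 1) ^ 7) :
    (√(2 * E ^ 2 * B * a ^ 5))⁻¹ * (N : ℝ) ^ ((s + t) / 2 - ε) * M ≤ T.card := by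
  have hN := h.N_real_pos
  have hT := h.card_T_pos
  have hM := h.M_pos
  have hPc := h.card_pos
  have hE0 : 0 < E := by rw [hE]; positivity
  have hB0 : 0 < B := by rw [hB]; positivity
  have hN1 : (1 : ℝ) ≤ N := by exact_mod_cast h.N_pos
  have h1 := h.card_tubes_lower_bound
  rw [← hE, ← hB] at h1
  have h15 := h.pow_fifteen_le hε hJ
  have hη5 : ((N : ℝ) ^ η) ^ 5 ≤ (N : ℝ) ^ ε := by
    rw [← Real.rpow_natCast, ← Real.rpow_mul hN.le]
    exact Real.rpow_le_rpow_of_exponent_le hN1 (by push_cast; linarith)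
  have hes : (N : ℝ) ^ s * (N : ℝ) ^ (-s) = 1 := by
    rw [← Real.rpow_add hN, add_neg_cancel, Real.rpow_zero]
  have h2 : M ^ 2 * P.card * (N : ℝ) ^ s
      ≤ E ^ 2 * B * a ^ 5 * ((N : ℝ) ^ ε * (N : ℝ) ^ ε) * T.card ^ 2 := by
    rw [div_pow, div_le_iff₀ (by positivity)] at h1
    refine le_of_mul_le_mul_right (a := P.card * (N : ℝ) ^ (-s)) ?_ (by positivity)
    calc M ^ 2 * P.card * (N : ℝ) ^ s * (P.card * (N : ℝ) ^ (-s))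
        = (M * P.card) ^ 2 * ((N : ℝ) ^ s * (N : ℝ) ^ (-s)) := by ring
      _ = (M * P.card) ^ 2 := by rw [hes, mul_one]
      _ ≤ _ := h1
      _ = E ^ 2 * B * a ^ 5 * (((N : ℝ) ^ η) ^ 5 * (S : ℝ) ^ 15) * T.card ^ 2
          * (P.card * (N : ℝ) ^ (-s)) := by ring
      _ ≤ _ := by gcongr
  have h3 : M ^ 2 * ((N : ℝ) ^ t * (N : ℝ) ^ s)
      ≤ (2 * E ^ 2 * B * a ^ 5) * ((N : ℝ) ^ ε * (N : ℝ) ^ ε) * T.card ^ 2 := by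
    have : M ^ 2 * ((N : ℝ) ^ t * (N : ℝ) ^ s) ≤ M ^ 2 * (2 * P.card * (N : ℝ) ^ s) := by gcongr
    linarith
  have hD : 0 < 2 * E ^ 2 * B * a ^ 5 := by positivity
  refine le_of_pow_le_pow_left₀ two_ne_zero hT.le ?_
  have e1 : ((N : ℝ) ^ ((s + t) / 2 - ε)) ^ 2 * ((N : ℝ) ^ ε * (N : ℝ) ^ ε)
      = (N : ℝ) ^ t * (N : ℝ) ^ s := by
    rw [sq, ← Real.rpow_add hN, ← Real.rpow_add hN, ← Real.rpow_add hN, ← Real.rpow_add hN]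
    congr 1
    ring
  rw [mul_pow, mul_pow, inv_pow, Real.sq_sqrt hD.le]
  refine le_of_mul_le_mul_right (a := (2 * E ^ 2 * B * a ^ 5) * ((N : ℝ) ^ ε * (N : ℝ) ^ ε)) ?_
    (by positivity)
  calc _ = M ^ 2 * (((N : ℝ) ^ ((s + t) / 2 - ε)) ^ 2 * ((N : ℝ) ^ ε * (N : ℝ) ^ ε)) := by
        field_simp
    _ ≤ _ := by rw [e1]; linarith

/-- **Semi-well-spaced corollary.** For every `ε > 0` and `η = ε²/1225`, for all
small enough dyadic `δ`: if `(𝒫, 𝒯)` is a `(δ, s, δ^{−η}, M)`-nice configuration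
with `|𝒫| ∼ δ^{−t}`, `t ∈ [s, 2−s]`, and `𝒫` satisfies the strong spacing
condition `|𝒫 ∩ Q|_δ ≲ δ^{−η} max(ρ^{2−s}|𝒫|_δ, (ρ/δ)^s)` for all dyadic
`ρ ∈ [δ, 1]` and `Q ∈ 𝒟_ρ(𝒫)`, then `|𝒯|_δ ≳_ε δ^{−(s+t)/2+ε} M`. -/
theorem semi_well_spaced_corollary (ε s t A : ℝ) (hε : 0 < ε)
    (hs0 : 0 < s) (hs1 : s ≤ 1) (hts : s ≤ t) (ht : t ≤ 2 - s) (hA : 1 ≤ A) :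
    ∃ δ₀ > (0 : ℝ), ∃ c > (0 : ℝ), ∀ (n : ℕ) (δ : ℝ), δ = 2 ^ (-(n : ℤ)) →
      δ < δ₀ →
      ∀ (M : ℕ) (P T : Finset (ℤ × ℤ)) (Tp : ℤ × ℤ → Finset (ℤ × ℤ)),
        NiceConfig δ s (δ ^ (-(ε ^ 2 / 1225))) M P T Tp →
        δ ^ (-t) ≤ 2 * (P.card : ℝ) → (P.card : ℝ) ≤ 2 * δ ^ (-t) →
        (∀ (j : ℕ) (ρ : ℝ), ρ = 2 ^ (-(j : ℤ)) → δ ≤ ρ →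
          ∀ Q : ℤ × ℤ, (dSq ρ Q ∩ sqUnion δ P).Nonempty →
            (covNum δ (sqUnion δ P ∩ dSq ρ Q) : ℝ) ≤
              A * δ ^ (-(ε ^ 2 / 1225)) *
                max (ρ ^ (2 - s) * (P.card : ℝ)) ((ρ / δ) ^ s)) →
        c * δ ^ (-(s + t) / 2 + ε) * (M : ℝ) ≤ (T.card : ℝ) := by
  rcases le_or_gt 1 ε with hε1 | hε1
  · refine ⟨1, one_pos, 1 / 2, by norm_num, fun n δ hδ hδ1 M P T Tp hnice hP1 _ _ => ?_⟩
    have hδ0 : 0 < δ := by rw [hδ]; positivity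
    obtain ⟨p, hp⟩ : P.Nonempty := by
      rw [← Finset.card_pos, ← Nat.cast_pos (α := ℝ)]
      have : 0 < δ ^ (-t) := by positivity
      linarith
    obtain ⟨hsub, -, hM, -, -⟩ := hnice.2.2 p hp
    have h1 : ((Tp p).card : ℝ) ≤ T.card := by exact_mod_cast Finset.card_le_card hsub
    have h2 : δ ^ (-(s + t) / 2 + ε) ≤ 1 := Real.rpow_le_one hδ0.le hδ1.le (by linarith)
    have h3 : δ ^ (-(s + t) / 2 + ε) * (M : ℝ) ≤ 1 * M := by gcongr
    linarith
  · obtain ⟨J, hJ⟩ := exists_nat_ge (15 / ε)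
    have hJ' : 15 ≤ ε * J := by rwa [div_le_iff₀ hε, mul_comm] at hJ
    obtain ⟨E, hE⟩ : ∃ E : ℝ, E = 8 * (2 * (J + 1 : ℕ) + 1) ^ (J + 1 + 1) * ((J + 1 : ℕ) + 1) :=
      ⟨_, rfl⟩
    obtain ⟨B, hB⟩ : ∃ B : ℝ, B = 2 ^ 80 * 9 ^ (J + 1) * ((J + 1 : ℕ) + 1) ^ 7 := ⟨_, rfl⟩
    have hE0 : 0 < E := by rw [hE]; positivity
    have hB0 : 0 < B := by rw [hB]; positivity
    refine ⟨2 ^ (-(((J + 1) * (J + 1) : ℕ) : ℤ)), by positivity,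
      (√(2 * E ^ 2 * B * (12 * A) ^ 5))⁻¹, by positivity, ?_⟩
    intro n δ hδ hδ₀ M P T Tp hnice hP1 hP2 hsp
    have hn : (J + 1) * (J + 1) ≤ n := by
      rw [hδ, zpow_lt_zpow_iff_right₀ (by norm_num)] at hδ₀
      omega
    obtain ⟨m, hm1, hnm, hmn⟩ := exists_nat_mul_between (Nat.succ_pos J) hn
    have hδN : δ = ((2 ^ n : ℕ) : ℝ)⁻¹ := by
      rw [hδ, zpow_neg, zpow_natCast]; push_cast; rfl
    have hN1 : (1 : ℝ) ≤ ((2 ^ n : ℕ) : ℝ) := by exact_mod_cast Nat.one_le_two_pow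
    have hpow : ∀ x : ℝ, δ ^ x = ((2 ^ n : ℕ) : ℝ) ^ (-x) := fun x => by
      rw [hδN, Real.inv_rpow (by positivity), Real.rpow_neg (by positivity)]
    rcases Nat.eq_zero_or_pos M with rfl | hM
    · simp
    have hconf := hnice.spacedConfig hδN hm1 hnm hmn hs0 hs1 hts ht hA
      (by rw [hpow]; exact Real.one_le_rpow hN1 (by rw [neg_neg]; positivity)) hM hP1 hP2 hsp
    rw [hpow, neg_neg, ← mul_assoc] at hconf
    rw [hpow, neg_neg] at hP1
    have := hconf.card_tubes_ge (t := t) (by positivity) hε hJ' (by nlinarith) hP1 hE hB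
    rw [hpow]
    convert this using 4
    ring

end
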